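/- Let 1 < p < ∞. Then there exists a constant c_p > 0, depending only on n and p, such that for every u ∈ C_c^∞(ℝ^n; ℝ^n), ‖(Du)_sym‖_{L^p(ℝ^n; ℝ^{n×n})} ≥ c_p ‖Du‖_{L^p(ℝ^n; ℝ^{n×n})}, where Du denotes the classical Jacobian matrix of u and (Du)_sym := (Du + (Du)^T)/2. (Classical Korn inequality on the whole space in L^p.) -/

import Mathlib

open MeasureTheory Metric Set Matrix
open scoped ENNReal InnerProductSpace

noncomputable section

/-- Points of `ℝ^n` with the Euclidean norm. -/
abbrev Eu (n : ℕ) := EuclideanSpace ℝ (Fin n)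

/-- Hypothesis (H0): `ρ` is a nonnegative radial kernel (with radial representation `ρb`),
locally integrable, with `∫ min{1,|x|⁻¹} ρ(x) dx < ∞`, and bounded below away from zero
on a closed ball of some radius `ε > 0`. -/
def IsKernelH0 (n : ℕ) (ρ : Eu n → ℝ) (ρb : ℝ → ℝ) (ε : ℝ) : Prop :=
  (∀ x, 0 ≤ ρ x) ∧
  (∀ x : Eu n, x ≠ 0 → ρ x = ρb ‖x‖) ∧
  LocallyIntegrable ρ volume ∧
  Integrable (fun x : Eu n => min 1 ‖x‖⁻¹ * ρ x) volume ∧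
  0 < ε ∧
  ∃ c > (0 : ℝ), ∀ x ∈ closedBall (0 : Eu n) ε, x ≠ 0 → c ≤ ρ x

/-- The auxiliary function `f_ρ(r) = r^(n-2) ρ̄(r)`. -/
def fRho (n : ℕ) (ρb : ℝ → ℝ) (r : ℝ) : ℝ := r ^ ((n : ℝ) - 2) * ρb r

/-- Hypothesis (H1): `f_ρ` and `r ↦ r^ν f_ρ(r)` are decreasing on `(0, ε)` for some `ν > 0`. -/
def IsKernelH1 (n : ℕ) (ρb : ℝ → ℝ) (ε : ℝ) : Prop :=
  ∃ ν > (0 : ℝ), AntitoneOn (fRho n ρb) (Ioo 0 ε) ∧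
    AntitoneOn (fun r => r ^ ν * fRho n ρb r) (Ioo 0 ε)

/-- Hypothesis (H2): `f_ρ` is smooth away from the origin and its derivatives satisfy
`|f_ρ^{(k)}(r)| ≤ C(k) r^(-k) f_ρ(r)` on `(0, ε)`. -/
def IsKernelH2 (n : ℕ) (ρb : ℝ → ℝ) (ε : ℝ) : Prop :=
  ContDiffOn ℝ (⊤ : ℕ∞) (fRho n ρb) (Ioi 0) ∧
  ∀ k : ℕ, 0 < k → ∃ C > (0 : ℝ), ∀ r ∈ Ioo (0 : ℝ) ε,
    |iteratedDerivWithin k (fRho n ρb) (Ioi 0) r| ≤ C * r ^ (-(k : ℝ)) * fRho n ρb r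

/-- Hypothesis (H3): `r ↦ r^(n+s-1) ρ̄(r)` is almost decreasing on `(0, ε)` for some `s ∈ (0,1)`. -/
def IsKernelH3 (n : ℕ) (ρb : ℝ → ℝ) (ε : ℝ) : Prop :=
  ∃ s ∈ Ioo (0 : ℝ) 1, ∃ C > (0 : ℝ), ∀ r₁ ∈ Ioo (0 : ℝ) ε, ∀ r₂ ∈ Ioo (0 : ℝ) ε, r₁ ≤ r₂ →
    C * (r₂ ^ ((n : ℝ) + s - 1) * ρb r₂) ≤ r₁ ^ ((n : ℝ) + s - 1) * ρb r₁

/-- Hypothesis (H4): `r ↦ r^(n+t-1) ρ̄(r)` is almost increasing on `(0, ε)` for some `t ∈ (0,1)`. -/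
def IsKernelH4 (n : ℕ) (ρb : ℝ → ℝ) (ε : ℝ) : Prop :=
  ∃ t ∈ Ioo (0 : ℝ) 1, ∃ C > (0 : ℝ), ∀ r₁ ∈ Ioo (0 : ℝ) ε, ∀ r₂ ∈ Ioo (0 : ℝ) ε, r₁ ≤ r₂ →
    C * (r₁ ^ ((n : ℝ) + t - 1) * ρb r₁) ≤ r₂ ^ ((n : ℝ) + t - 1) * ρb r₂

variable {n : ℕ}

/-- Nonlocal gradient of a scalar field:
`D_ρ u(x) = ∫ ((u(x) - u(y))/|x-y|) ((x-y)/|x-y|) ρ(x-y) dy`. -/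
def nlGradS (ρ : Eu n → ℝ) (u : Eu n → ℝ) (x : Eu n) : Eu n :=
  ∫ y, ((u x - u y) * ρ (x - y) / ‖x - y‖ ^ 2) • (x - y)

/-- The (i,j) entry of the integrand of the nonlocal gradient of a vector field. -/
def nlGradMInt (ρ : Eu n → ℝ) (u : Eu n → Eu n) (x : Eu n) (i j : Fin n) : Eu n → ℝ :=
  fun y => (u x - u y) i * (x - y) j * ρ (x - y) / ‖x - y‖ ^ 2

/-- Nonlocal gradient of a vector field, as a matrix:
`D_ρ u(x) = ∫ ((u(x)-u(y))/|x-y|) ⊗ ((x-y)/|x-y|) ρ(x-y) dy`. -/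
def nlGradM (ρ : Eu n → ℝ) (u : Eu n → Eu n) (x : Eu n) : Matrix (Fin n) (Fin n) ℝ :=
  Matrix.of fun i j => ∫ y, nlGradMInt ρ u x i j y

/-- The integrand of the nonlocal divergence of a vector field. -/
def nlDivVInt (ρ : Eu n → ℝ) (u : Eu n → Eu n) (x : Eu n) : Eu n → ℝ :=
  fun y => ⟪u x - u y, x - y⟫_ℝ * ρ (x - y) / ‖x - y‖ ^ 2

/-- Nonlocal divergence of a vector field:
`div_ρ u(x) = ∫ ((u(x)-u(y))·(x-y)/|x-y|²) ρ(x-y) dy`. -/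
def nlDivV (ρ : Eu n → ℝ) (u : Eu n → Eu n) (x : Eu n) : ℝ :=
  ∫ y, nlDivVInt ρ u x y

/-- The i-th component of the integrand of the nonlocal divergence of a matrix field. -/
def nlDivMInt (ρ : Eu n → ℝ) (Φ : Eu n → Matrix (Fin n) (Fin n) ℝ) (x : Eu n) (i : Fin n) :
    Eu n → ℝ :=
  fun y => (∑ j, (Φ x i j - Φ y i j) * (x - y) j) * ρ (x - y) / ‖x - y‖ ^ 2

/-- Nonlocal divergence of a matrix field:
`div_ρ Φ(x) = ∫ ((Φ(x)-Φ(y))/|x-y|) ((x-y)/|x-y|) ρ(x-y) dy ∈ ℝ^n`. -/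
def nlDivM (ρ : Eu n → ℝ) (Φ : Eu n → Matrix (Fin n) (Fin n) ℝ) (x : Eu n) : Eu n :=
  (WithLp.equiv 2 (Fin n → ℝ)).symm fun i => ∫ y, nlDivMInt ρ Φ x i y

/-- Frobenius inner product `A : B = Σ_{ij} a_{ij} b_{ij}` of matrices. -/
def frobInner (A B : Matrix (Fin n) (Fin n) ℝ) : ℝ := ∑ i, ∑ j, A i j * B i j

/-- Symmetric part of a matrix, `M_sym = (M + Mᵀ)/2`. -/
def symPart (M : Matrix (Fin n) (Fin n) ℝ) : Matrix (Fin n) (Fin n) ℝ :=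
  (1 / 2 : ℝ) • (M + Mᵀ)

/-- The potential `Q_ρ(x) = ∫_{|x|}^∞ ρ̄(t)/t dt`. -/
def Qker (n : ℕ) (ρb : ℝ → ℝ) (x : Eu n) : ℝ := ∫ t in Ioi ‖x‖, ρb t / t

/-- Classical Jacobian matrix of a vector field, `(Du)_{ij} = ∂u_i/∂x_j`. -/
def jacobianM (u : Eu n → Eu n) (x : Eu n) : Matrix (Fin n) (Fin n) ℝ :=
  Matrix.of fun i j => fderiv ℝ (fun z => u z i) x (EuclideanSpace.single j 1)

/-- Rank-one matrix `a ⊗ b = (a_i b_j)`. -/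
def tensorP (a b : Eu n) : Matrix (Fin n) (Fin n) ℝ := Matrix.of fun i j => a i * b j

/-- Isotropic elasticity tensor `C[M] = 2μ M_sym + λ (tr M) I`. -/
def isoC (μ lam : ℝ) (M : Matrix (Fin n) (Fin n) ℝ) : Matrix (Fin n) (Fin n) ℝ :=
  (2 * μ) • symPart M + (lam * Matrix.trace M) • (1 : Matrix (Fin n) (Fin n) ℝ)

/-- Fourier transform `𝓕 f(ξ) = ∫ f(x) e^{-2πi x·ξ} dx` of a complex-valued function on ℝ^n. -/
def fInt (f : Eu n → ℂ) (ξ : Eu n) : ℂ :=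
  ∫ x, f x * Complex.exp (-(2 * Real.pi * (⟪x, ξ⟫_ℝ : ℝ) * Complex.I))

/-- The nonlocal Laplacian `(-Δ)_ρ v = -div_ρ (D_ρ v)` of a vector field. -/
def nlLap (ρ : Eu n → ℝ) (v : Eu n → Eu n) (x : Eu n) : Eu n :=
  -nlDivM ρ (fun z => nlGradM ρ v z) x

/-- The i-th component of the integrand of `K_{ρ,φ}(Φ)` from the nonlocal Leibniz rule. -/
def KtermInt (ρ : Eu n → ℝ) (φ : Eu n → ℝ) (Φ : Eu n → Matrix (Fin n) (Fin n) ℝ)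
    (x : Eu n) (i : Fin n) : Eu n → ℝ :=
  fun y => (φ x - φ y) * (∑ j, Φ y i j * (x - y) j) * ρ (x - y) / ‖x - y‖ ^ 2

/-- `K_{ρ,φ}(Φ)(x) = ∫ ((φ(x)-φ(y))/|x-y|) Φ(y) ((x-y)/|x-y|) ρ(x-y) dy`. -/
def Kterm (ρ : Eu n → ℝ) (φ : Eu n → ℝ) (Φ : Eu n → Matrix (Fin n) (Fin n) ℝ)
    (x : Eu n) : Eu n :=
  (WithLp.equiv 2 (Fin n → ℝ)).symm fun i => ∫ y, KtermInt ρ φ Φ x i y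

/-- Classical divergence of a vector field. -/
def divCl (w : Eu n → Eu n) (x : Eu n) : ℝ :=
  ∑ i, fderiv ℝ (fun z => w z i) x (EuclideanSpace.single i 1)

/-! ### The Bellman function -/

/-- Base of the power occurring in the Bellman function. -/
def bellmanW (p q u v : ℝ) : ℝ := u ^ p + v ^ q

/-- The Bellman function `K v^q + u² (u^p + v^q)^(1 - 2/p)`. -/
def bellman (p q K u v : ℝ) : ℝ := K * v ^ q + u ^ 2 * bellmanW p q u v ^ (1 - 2 / p)

/-- First partial derivative of `bellman` in `u`. -/
def bellmanU (p q u v : ℝ) : ℝ :=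
  2 * u * bellmanW p q u v ^ (1 - 2 / p) +
    u ^ 2 * ((1 - 2 / p) * (p * u ^ (p - 1)) * bellmanW p q u v ^ (1 - 2 / p - 1))

/-- First partial derivative of `bellman` in `v`. -/
def bellmanV (p q K u v : ℝ) : ℝ :=
  K * (q * v ^ (q - 1)) +
    u ^ 2 * ((1 - 2 / p) * (q * v ^ (q - 1)) * bellmanW p q u v ^ (1 - 2 / p - 1))

/-- Second partial derivative of `bellman` in `u`. -/
def bellmanUU (p q u v : ℝ) : ℝ :=
  2 * bellmanW p q u v ^ (1 - 2 / p) +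
    4 * u * ((1 - 2 / p) * (p * u ^ (p - 1)) * bellmanW p q u v ^ (1 - 2 / p - 1)) +
    u ^ 2 * ((1 - 2 / p) * (p * ((p - 1) * u ^ (p - 2))) * bellmanW p q u v ^ (1 - 2 / p - 1)) +
    u ^ 2 * ((1 - 2 / p) * (1 - 2 / p - 1) * (p * u ^ (p - 1)) ^ 2 *
      bellmanW p q u v ^ (1 - 2 / p - 2))

/-- Mixed partial derivative of `bellman`. -/
def bellmanUV (p q u v : ℝ) : ℝ :=
  2 * u * ((1 - 2 / p) * (q * v ^ (q - 1)) * bellmanW p q u v ^ (1 - 2 / p - 1)) +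
    u ^ 2 * ((1 - 2 / p) * (1 - 2 / p - 1) * (p * u ^ (p - 1)) * (q * v ^ (q - 1)) *
      bellmanW p q u v ^ (1 - 2 / p - 2))

/-- Second partial derivative of `bellman` in `v`. -/
def bellmanVV (p q K u v : ℝ) : ℝ :=
  K * (q * ((q - 1) * v ^ (q - 2))) +
    u ^ 2 * ((1 - 2 / p) * (q * ((q - 1) * v ^ (q - 2))) * bellmanW p q u v ^ (1 - 2 / p - 1)) +
    u ^ 2 * ((1 - 2 / p) * (1 - 2 / p - 1) * (q * v ^ (q - 1)) ^ 2 *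
      bellmanW p q u v ^ (1 - 2 / p - 2))

section Bellman

variable {p q K : ℝ} {a b : ℝ → ℝ} {a' b' s : ℝ}

lemma bellmanW_pos {u v : ℝ} (hu : 0 < u) (hv : 0 < v) : 0 < bellmanW p q u v := by
  unfold bellmanW; positivity

lemma HasDerivAt.bellmanW (ha : HasDerivAt a a' s) (hb : HasDerivAt b b' s)
    (ha0 : 0 < a s) (hb0 : 0 < b s) :
    HasDerivAt (fun r => bellmanW p q (a r) (b r))
      (p * a s ^ (p - 1) * a' + q * b s ^ (q - 1) * b') s := by
  unfold _root_.bellmanW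
  refine ((ha.rpow_const (p := p) (Or.inl ha0.ne')).add
    (hb.rpow_const (p := q) (Or.inl hb0.ne'))).congr_deriv ?_
  ring

lemma HasDerivAt.bellman (ha : HasDerivAt a a' s) (hb : HasDerivAt b b' s)
    (ha0 : 0 < a s) (hb0 : 0 < b s) :
    HasDerivAt (fun r => bellman p q K (a r) (b r))
      (bellmanU p q (a s) (b s) * a' + bellmanV p q K (a s) (b s) * b') s := by
  unfold _root_.bellman bellmanU bellmanV
  have hW := bellmanW_pos (p := p) (q := q) ha0 hb0
  refine (((hb.rpow_const (p := q) (Or.inl hb0.ne')).const_mul K).add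
    ((ha.pow 2).mul ((ha.bellmanW hb ha0 hb0).rpow_const (p := 1 - 2 / p)
      (Or.inl hW.ne')))).congr_deriv ?_
  simp only [Pi.pow_apply]
  push_cast
  ring

lemma HasDerivAt.bellmanU (ha : HasDerivAt a a' s) (hb : HasDerivAt b b' s)
    (ha0 : 0 < a s) (hb0 : 0 < b s) :
    HasDerivAt (fun r => bellmanU p q (a r) (b r))
      (bellmanUU p q (a s) (b s) * a' + bellmanUV p q (a s) (b s) * b') s := by
  unfold _root_.bellmanU bellmanUU bellmanUV
  have hW := bellmanW_pos (p := p) (q := q) ha0 hb0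
  have hw := ha.bellmanW (p := p) (q := q) hb ha0 hb0
  have h1 := (ha.const_mul 2).mul (hw.rpow_const (p := 1 - 2 / p) (Or.inl hW.ne'))
  have h2 := (((ha.rpow_const (p := p - 1) (Or.inl ha0.ne')).const_mul p).const_mul
    (1 - 2 / p)).mul (hw.rpow_const (p := 1 - 2 / p - 1) (Or.inl hW.ne'))
  refine (h1.add ((ha.pow 2).mul h2)).congr_deriv ?_
  simp only [Pi.pow_apply, Pi.mul_apply]
  rw [show p - 1 - 1 = p - 2 by ring, show 1 - 2 / p - 1 - 1 = 1 - 2 / p - 2 by ring]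
  push_cast
  ring

lemma HasDerivAt.bellmanV (ha : HasDerivAt a a' s) (hb : HasDerivAt b b' s)
    (ha0 : 0 < a s) (hb0 : 0 < b s) :
    HasDerivAt (fun r => bellmanV p q K (a r) (b r))
      (bellmanUV p q (a s) (b s) * a' + bellmanVV p q K (a s) (b s) * b') s := by
  unfold _root_.bellmanV bellmanUV bellmanVV
  have hW := bellmanW_pos (p := p) (q := q) ha0 hb0
  have hw := ha.bellmanW (p := p) (q := q) hb ha0 hb0
  have h0 := (hb.rpow_const (p := q - 1) (Or.inl hb0.ne')).const_mul q
  have h2 := (h0.const_mul (1 - 2 / p)).mul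
    (hw.rpow_const (p := 1 - 2 / p - 1) (Or.inl hW.ne'))
  refine ((h0.const_mul K).add ((ha.pow 2).mul h2)).congr_deriv ?_
  simp only [Pi.pow_apply, Pi.mul_apply]
  rw [show q - 1 - 1 = q - 2 by ring, show 1 - 2 / p - 1 - 1 = 1 - 2 / p - 2 by ring]
  push_cast
  ring

/-- Second derivative of a bellman composite, as a quadratic form. -/
def bellmanHess (p q K u v a b : ℝ) : ℝ :=
  bellmanUU p q u v * a ^ 2 + 2 * bellmanUV p q u v * a * b + bellmanVV p q K u v * b ^ 2

/-- The constant for which the Bellman function is sufficiently convex. -/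
def bellmanK (q : ℝ) : ℝ := (65 + q ^ 2) / (q * (q - 1))

lemma bellman_nonneg {u v : ℝ} (hq : 1 < q) (hu : 0 < u) (hv : 0 < v) :
    0 ≤ bellman p q (bellmanK q) u v := by
  have h0 : 0 < q - 1 := by linarith
  have h1 : 0 < q := by linarith
  have := bellmanW_pos (p := p) (q := q) hu hv
  unfold bellman bellmanK
  positivity

lemma sq_mul_bellmanW_rpow_le {u v : ℝ} (hp : 2 ≤ p) (hu : 0 < u) (hv : 0 < v) :
    u ^ 2 * bellmanW p q u v ^ (-(2 / p)) ≤ 1 := by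
  have hW := bellmanW_pos (p := p) (q := q) hu hv
  have h1 : u ^ 2 ≤ bellmanW p q u v ^ (2 / p) := by
    calc u ^ 2 = (u ^ p) ^ (2 / p) := by
          rw [← Real.rpow_mul hu.le, mul_div_cancel₀ _ (by linarith)]; norm_cast
      _ ≤ _ := by
          apply Real.rpow_le_rpow (by positivity) _ (by positivity)
          unfold bellmanW; linarith [Real.rpow_pos_of_pos hv q]
  rw [Real.rpow_neg hW.le]
  exact mul_inv_le_one_of_le₀ h1 (by positivity)

lemma bellman_le {u v : ℝ} (hp : 2 ≤ p) (hq : 1 < q) (hu : 0 < u) (hv : 0 < v) :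
    bellman p q (bellmanK q) u v ≤ (bellmanK q + 1) * (u ^ p + v ^ q) := by
  have h0 : 0 < q - 1 := by linarith
  have h1 : 0 < q := by linarith
  have hW := bellmanW_pos (p := p) (q := q) hu hv
  have hK : 0 < bellmanK q := by unfold bellmanK; positivity
  have h2 : u ^ 2 * bellmanW p q u v ^ (1 - 2 / p) ≤ bellmanW p q u v := by
    have := mul_le_mul_of_nonneg_right (sq_mul_bellmanW_rpow_le (q := q) hp hu hv) hW.le
    rw [sub_eq_add_neg, Real.rpow_add hW, Real.rpow_one]
    linarith
  have hup := Real.rpow_pos_of_pos hu p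
  unfold bellman
  unfold bellmanW at h2 ⊢
  nlinarith

set_option maxHeartbeats 1000000 in
lemma bellmanHess_ge {u v : ℝ} (hpq : p.HolderConjugate q) (hp : 2 ≤ p) (hu : 0 < u)
    (hv : 0 < v) (a b : ℝ) :
    bellmanW p q u v ^ (1 - 2 / p) * a ^ 2 + (bellmanW p q u v ^ (1 - 2 / p))⁻¹ * b ^ 2 ≤
      bellmanHess p q (bellmanK q) u v a b := by
  have hq : 1 < q := hpq.symm.lt
  have hq0 : 0 < q := by linarith
  have hq1 : 0 < q - 1 := by linarith
  have hp0 : 0 < p := by linarith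
  have hq2 : q ≤ 2 := by
    have := hpq.inv_add_inv_eq_one
    have h1 : p⁻¹ ≤ 2⁻¹ := inv_anti₀ (by norm_num) hp
    have h2 : 2⁻¹ ≤ q⁻¹ := by norm_num at *; linarith
    exact (inv_le_inv₀ (by norm_num) hq0).1 h2
  have hqp : q / p = q - 1 := by
    rw [div_eq_iff hp0.ne', hpq.symm.sub_one_mul_conj]
  set w := bellmanW p q u v with hw
  have hW : 0 < w := bellmanW_pos hu hv
  set θ := 1 - 2 / p with hθ
  have h2p : 2 / p ≤ 1 := by rw [div_le_one hp0]; exact hp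
  have h2p0 : 0 < 2 / p := by positivity
  have hθ0 : 0 ≤ θ := by rw [hθ]; linarith
  have hθ1 : θ ≤ 1 := by rw [hθ]; linarith
  set α := w ^ θ with hα
  have hα0 : 0 < α := by positivity
  -- normalized quantities
  set X := u ^ p / w with hX
  set Y := v ^ q / w with hY
  have hXY : X + Y = 1 := by rw [hX, hY, ← add_div]; exact div_self hW.ne'
  have hX0 : 0 < X := by positivity
  have hY0 : 0 < Y := by positivity
  have e1 : w ^ (θ - 1) = α / w := by rw [Real.rpow_sub_one hW.ne']
  have e2 : w ^ (θ - 2) = α / w ^ 2 := by rw [Real.rpow_sub hW]; norm_cast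
  have e3 : u ^ (p - 1) = u ^ p / u := by rw [Real.rpow_sub_one hu.ne']
  have e4 : u ^ (p - 2) = u ^ p / u ^ 2 := by rw [Real.rpow_sub hu]; norm_cast
  have e5 : v ^ (q - 1) = v ^ q / v := by rw [Real.rpow_sub_one hv.ne']
  have e6 : v ^ (q - 2) = v ^ q / v ^ 2 := by rw [Real.rpow_sub hv]; norm_cast
  have eX : u ^ p = X * w := by rw [hX]; field_simp
  have eY : v ^ q = Y * w := by rw [hY]; field_simp
  have hθp : θ * p = p - 2 := by rw [hθ]; field_simp
  -- second derivative in `u`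
  have hUU : 2 * α ≤ bellmanUU p q u v := by
    unfold bellmanUU
    rw [← hw, ← hθ, e1, e2, e3, e4, ← hα, eX]
    have : 2 * α + 4 * u * (θ * (p * (X * w / u)) * (α / w)) +
        u ^ 2 * (θ * (p * ((p - 1) * (X * w / u ^ 2))) * (α / w)) +
        u ^ 2 * (θ * (θ - 1) * (p * (X * w / u)) ^ 2 * (α / w ^ 2)) =
        2 * α + α * (θ * p) * X * (4 + (p - 1) - (p - θ * p) * X) := by
      field_simp; ring
    rw [this, hθp]
    have : 0 ≤ α * (p - 2) * X * (4 + (p - 1) - (p - (p - 2)) * X) := by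
      have : 0 ≤ p - 2 := by linarith
      have : 0 ≤ 4 + (p - 1) - (p - (p - 2)) * X := by nlinarith
      positivity
    linarith
  -- mixed derivative
  have hcross : u ^ 2 * (v ^ (q - 1)) ^ 2 ≤ (w ^ (2 / p)) ^ 2 := by
    have h1 : u ^ 2 ≤ w ^ (2 / p) := by
      have := sq_mul_bellmanW_rpow_le (q := q) hp hu hv
      rw [← hw, Real.rpow_neg hW.le, ← div_eq_mul_inv, div_le_one (by positivity)] at this
      exact this
    have h2 : (v ^ (q - 1)) ^ 2 ≤ w ^ (2 / p) := by
      calc (v ^ (q - 1)) ^ 2 = (v ^ q) ^ (2 / p) := by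
            rw [← Real.rpow_mul hv.le, ← Real.rpow_natCast, ← Real.rpow_mul hv.le, ← hqp]
            congr 1; push_cast; ring
        _ ≤ _ := by
            apply Real.rpow_le_rpow (by positivity) _ (by positivity)
            rw [hw]; unfold bellmanW; linarith [Real.rpow_pos_of_pos hu p]
    rw [sq (w ^ (2 / p))]
    gcongr
  have hαw : α / w = (w ^ (2 / p))⁻¹ := by
    rw [← e1, hθ, ← Real.rpow_neg hW.le]; congr 1; ring
  have hprod : u * v ^ (q - 1) * (α / w) ≤ 1 := by
    rw [hαw]
    apply mul_inv_le_one_of_le₀ _ (by positivity)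
    rw [← mul_pow] at hcross
    exact (sq_le_sq₀ (by positivity) (by positivity)).1 hcross
  have hUV : |bellmanUV p q u v| ≤ 8 := by
    unfold bellmanUV
    rw [← hw, ← hθ, e1, e2, e3, eX]
    have : 2 * u * (θ * (q * v ^ (q - 1)) * (α / w)) +
        u ^ 2 * (θ * (θ - 1) * (p * (X * w / u)) * (q * v ^ (q - 1)) * (α / w ^ 2)) =
        (2 * θ * q * (1 - X)) * (u * v ^ (q - 1) * (α / w)) := by
      have h5 : (θ - 1) * p = -2 := by linarith
      have : 2 * u * (θ * (q * v ^ (q - 1)) * (α / w)) +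
        u ^ 2 * (θ * (θ - 1) * (p * (X * w / u)) * (q * v ^ (q - 1)) * (α / w ^ 2)) =
        (2 * θ * q + θ * q * ((θ - 1) * p) * X) * (u * v ^ (q - 1) * (α / w)) := by
          field_simp
      rw [this, h5]; ring
    rw [this, show 1 - X = Y by linarith, abs_of_nonneg (by positivity)]
    have hpos : 0 < u * v ^ (q - 1) * (α / w) := by positivity
    have hb : 2 * θ * q * Y ≤ 8 := by
      have hY1 : Y ≤ 1 := by linarith
      calc 2 * θ * q * Y ≤ 2 * 1 * 2 * 1 := by gcongr
        _ ≤ 8 := by norm_num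
    calc 2 * θ * q * Y * (u * v ^ (q - 1) * (α / w)) ≤ 8 * 1 := by gcongr
      _ = 8 := by norm_num
  -- second derivative in `v`
  have hu2 : u ^ 2 * (α / w) ≤ 1 := by
    have := sq_mul_bellmanW_rpow_le (q := q) hp hu hv
    rwa [← hw, Real.rpow_neg hW.le, ← hαw] at this
  have hVV : 65 * v ^ (q - 2) ≤ bellmanVV p q (bellmanK q) u v := by
    unfold bellmanVV bellmanK
    rw [← hw, ← hθ, e1, e2, e5]
    have h6 : v ^ q / v * (v ^ q / v) = v ^ (q - 2) * (Y * w) := by rw [e6, ← eY]; field_simp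
    have : (65 + q ^ 2) / (q * (q - 1)) * (q * ((q - 1) * v ^ (q - 2))) +
        u ^ 2 * (θ * (q * ((q - 1) * v ^ (q - 2))) * (α / w)) +
        u ^ 2 * (θ * (θ - 1) * (q * (v ^ q / v)) ^ 2 * (α / w ^ 2)) =
        v ^ (q - 2) * (65 + q ^ 2 + θ * q * (q - 1) * (u ^ 2 * (α / w))
          - θ * (1 - θ) * q ^ 2 * Y * (u ^ 2 * (α / w))) := by
      have : (q * (v ^ q / v)) ^ 2 = q ^ 2 * (v ^ (q - 2) * (Y * w)) := by rw [← h6]; ring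
      rw [this]
      field_simp; ring
    rw [this, mul_comm]
    have hz : 0 ≤ u ^ 2 * (α / w) := by positivity
    have h7 : θ * (1 - θ) * q ^ 2 * Y * (u ^ 2 * (α / w)) ≤ 1 * 1 * q ^ 2 * 1 * 1 := by
      have : 0 ≤ 1 - θ := by linarith
      have hY1 : Y ≤ 1 := by linarith
      gcongr
      linarith
    have h8 : 0 ≤ θ * q * (q - 1) * (u ^ 2 * (α / w)) := by positivity
    gcongr
    linarith
  have hinv : α⁻¹ ≤ v ^ (q - 2) := by
    have : v ^ (2 - q) ≤ α := by
      calc v ^ (2 - q) = (v ^ q) ^ θ := by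
            rw [← Real.rpow_mul hv.le, hθ]; congr 1
            have : q * (1 - 2 / p) = q - 2 * (q / p) := by ring
            rw [this, hqp]; ring
        _ ≤ _ := by
            apply Real.rpow_le_rpow (by positivity) _ hθ0
            rw [hw]; unfold bellmanW; linarith [Real.rpow_pos_of_pos hu p]
    rw [show q - 2 = -(2 - q) by ring, Real.rpow_neg hv.le]
    exact inv_anti₀ (by positivity) this
  have hVV' : 65 * α⁻¹ ≤ bellmanVV p q (bellmanK q) u v := by linarith
  unfold bellmanHess
  have hab : -(16 * |a| * |b|) ≤ 2 * bellmanUV p q u v * a * b := by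
    have : |2 * bellmanUV p q u v * a * b| ≤ 16 * |a| * |b| := by
      rw [abs_mul, abs_mul, abs_mul, abs_two]
      gcongr; linarith
    linarith [neg_abs_le (2 * bellmanUV p q u v * a * b)]
  have hsq : 16 * |a| * |b| ≤ α * a ^ 2 + 64 * α⁻¹ * b ^ 2 := by
    have : 0 ≤ α⁻¹ * (α * |a| - 8 * |b|) ^ 2 := by positivity
    have h9 : α⁻¹ * (α * |a| - 8 * |b|) ^ 2 = α * |a| ^ 2 + 64 * α⁻¹ * |b| ^ 2 - 16 * |a| * |b| := by
      field_simp; ring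
    rw [h9, sq_abs, sq_abs] at this
    linarith
  nlinarith [sq_nonneg a, sq_nonneg b]

end Bellman

/-! ### Parametric integrals against continuous compactly supported weights -/

lemma continuousOn_integral_mul_of_hasCompactSupport {X : Type*} [TopologicalSpace X]
    {φ : Eu n → ℝ} (hφ : Continuous φ)
    (hs : HasCompactSupport φ) {U : Set X} {b : X → Eu n → ℝ}
    (hb : ContinuousOn (Function.uncurry b) (U ×ˢ univ)) :
    ContinuousOn (fun s => ∫ y, b s y * φ y) U := by
  refine continuousOn_integral_of_compact_support (k := tsupport φ) hs ?_ ?_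
  · exact hb.mul (hφ.comp continuous_snd).continuousOn
  · intro s y _ hy
    rw [image_eq_zero_of_notMem_tsupport hy, mul_zero]

lemma hasDerivAt_integral_mul_of_hasCompactSupport {φ : Eu n → ℝ} (hφ : Continuous φ)
    (hs : HasCompactSupport φ) {U : Set ℝ} (hU : IsOpen U) {b b' : ℝ → Eu n → ℝ}
    (hb : ContinuousOn (Function.uncurry b) (U ×ˢ univ))
    (hb' : ContinuousOn (Function.uncurry b') (U ×ˢ univ))
    (hd : ∀ s ∈ U, ∀ y, HasDerivAt (fun r => b r y) (b' s y) s) {s : ℝ} (hsU : s ∈ U) :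
    HasDerivAt (fun r => ∫ y, b r y * φ y) (∫ y, b' s y * φ y) s := by
  have slice : ∀ {c : ℝ → Eu n → ℝ}, ContinuousOn (Function.uncurry c) (U ×ˢ univ) →
      ∀ r ∈ U, Continuous (fun y => c r y * φ y) := by
    intro c hc r hr
    refine Continuous.mul ?_ hφ
    rw [← continuousOn_univ]
    exact hc.comp (f := fun y => (r, y)) (by fun_prop) (fun y _ => ⟨hr, mem_univ _⟩)
  obtain ⟨δ, hδ, hball⟩ := Metric.isOpen_iff.1 hU s hsU
  have hK : IsCompact (closedBall s (δ / 2) ×ˢ tsupport φ) :=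
    (isCompact_closedBall _ _).prod hs
  have hsub : closedBall s (δ / 2) ⊆ U := (closedBall_subset_ball (by linarith)).trans hball
  obtain ⟨C, hC⟩ := hK.exists_bound_of_continuousOn
    (hb'.mono (prod_mono hsub (subset_univ _)))
  refine (hasDerivAt_integral_of_dominated_loc_of_deriv_le (F := fun r y => b r y * φ y)
    (F' := fun r y => b' r y * φ y) (bound := fun y => C * |φ y|)
    (s := closedBall s (δ / 2)) (closedBall_mem_nhds s (by linarith)) ?_ ?_ ?_ ?_ ?_ ?_).2
  · filter_upwards [hU.mem_nhds hsU] with r hr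
    exact (slice hb r hr).aestronglyMeasurable
  · exact (slice hb s hsU).integrable_of_hasCompactSupport hs.mul_left
  · exact (slice hb' s hsU).aestronglyMeasurable
  · refine Filter.Eventually.of_forall fun y r hr => ?_
    rw [norm_mul, Real.norm_eq_abs (φ y)]
    by_cases hy : y ∈ tsupport φ
    · exact mul_le_mul_of_nonneg_right (hC (r, y) ⟨hr, hy⟩) (abs_nonneg _)
    · simp [image_eq_zero_of_notMem_tsupport hy]
  · exact (continuous_const.mul hφ.abs).integrable_of_hasCompactSupport
      (hs.comp_left (g := fun z => |z|) abs_zero).mul_left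
  · exact Filter.Eventually.of_forall fun y r hr => (hd r (hsub hr) y).mul_const _

/-! ### The heat kernel -/

/-- The heat kernel on `ℝ^n`. -/
def heatK (t : ℝ) (z : Eu n) : ℝ := (4 * Real.pi * t) ^ (-(n / 2 : ℝ)) * Real.exp (-‖z‖ ^ 2 / (4 * t))

/-- First spatial derivatives of the heat kernel. -/
def heatKD (i : Fin n) (t : ℝ) (z : Eu n) : ℝ := -(z i / (2 * t)) * heatK t z

/-- Second spatial derivatives of the heat kernel. -/
def heatKDD (i : Fin n) (t : ℝ) (z : Eu n) : ℝ :=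
  (z i ^ 2 / (4 * t ^ 2) - 1 / (2 * t)) * heatK t z

lemma heatK_pos {t : ℝ} (ht : 0 < t) (z : Eu n) : 0 < heatK t z := by
  unfold heatK; positivity

lemma heatK_neg (t : ℝ) (z : Eu n) : heatK t (-z) = heatK t z := by simp [heatK]

lemma heatK_sub_comm (t : ℝ) (x y : Eu n) : heatK t (x - y) = heatK t (y - x) := by
  rw [← heatK_neg, neg_sub]

lemma continuousOn_heatK :
    ContinuousOn (Function.uncurry (heatK (n := n))) (Ioi 0 ×ˢ univ) := by
  unfold heatK Function.uncurry
  refine ContinuousOn.mul ?_ ?_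
  · refine ContinuousOn.rpow_const (by fun_prop) ?_
    rintro ⟨t, z⟩ ⟨ht, -⟩
    left
    have : 0 < t := ht
    positivity
  · refine Real.continuous_exp.comp_continuousOn (ContinuousOn.div (by fun_prop) (by fun_prop) ?_)
    rintro ⟨t, z⟩ ⟨ht, -⟩
    have : 0 < t := ht
    positivity

lemma continuousOn_heatKD (i : Fin n) :
    ContinuousOn (Function.uncurry (heatKD i)) (Ioi 0 ×ˢ univ) := by
  refine ContinuousOn.mul (ContinuousOn.neg (ContinuousOn.div (by fun_prop) (by fun_prop) ?_))
    continuousOn_heatK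
  rintro ⟨t, z⟩ ⟨ht, -⟩
  have : 0 < t := ht
  positivity

lemma continuousOn_heatKDD (i : Fin n) :
    ContinuousOn (Function.uncurry (heatKDD i)) (Ioi 0 ×ˢ univ) := by
  refine ContinuousOn.mul (ContinuousOn.sub (ContinuousOn.div (by fun_prop) (by fun_prop) ?_)
    (ContinuousOn.div (by fun_prop) (by fun_prop) ?_)) continuousOn_heatK
  all_goals
    rintro ⟨t, z⟩ ⟨ht, -⟩
    have : 0 < t := ht
    positivity

lemma continuous_heatK {t : ℝ} (ht : 0 < t) : Continuous (heatK (n := n) t) := by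
  rw [← continuousOn_univ]
  exact continuousOn_heatK.comp (f := fun z => (t, z)) (by fun_prop) fun z _ => ⟨ht, mem_univ _⟩

lemma continuous_heatKD (i : Fin n) {t : ℝ} (ht : 0 < t) : Continuous (heatKD i t) := by
  rw [← continuousOn_univ]
  exact (continuousOn_heatKD i).comp (f := fun z => (t, z)) (by fun_prop)
    fun z _ => ⟨ht, mem_univ _⟩

lemma hasDerivAt_coord (i : Fin n) (z : Eu n) :
    HasDerivAt (fun s : ℝ => (z + s • EuclideanSpace.single i (1 : ℝ)) i) 1 0 := by
  simpa using (hasDerivAt_id (0 : ℝ)).const_add (z i)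

lemma hasLineDerivAt_heatK (i : Fin n) {t : ℝ} (ht : 0 < t) (z : Eu n) :
    HasLineDerivAt ℝ (heatK t) (heatKD i t z) z (EuclideanSpace.single i 1) := by
  have h1 : HasDerivAt (fun s : ℝ => ‖z + s • EuclideanSpace.single i (1 : ℝ)‖ ^ 2) (2 * z i) 0 := by
    have : HasDerivAt (fun s : ℝ => z + s • EuclideanSpace.single i (1 : ℝ))
        (EuclideanSpace.single i (1 : ℝ)) 0 := by
      simpa using ((hasDerivAt_id (0 : ℝ)).smul_const (EuclideanSpace.single i (1 : ℝ))).const_add z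
    simpa [EuclideanSpace.inner_single_right] using this.norm_sq
  have h2 := ((h1.neg.div_const (4 * t)).exp).const_mul ((4 * Real.pi * t) ^ (-(n / 2 : ℝ)))
  unfold HasLineDerivAt
  refine h2.congr_deriv ?_
  simp only [heatKD, heatK, zero_smul, add_zero, Pi.neg_apply]
  field_simp
  ring

lemma hasLineDerivAt_heatKD (i : Fin n) {t : ℝ} (ht : 0 < t) (z : Eu n) :
    HasLineDerivAt ℝ (heatKD i t) (heatKDD i t z) z (EuclideanSpace.single i 1) := by
  have h1 := hasLineDerivAt_heatK i ht z
  unfold HasLineDerivAt at h1 ⊢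
  refine ((((hasDerivAt_coord i z).div_const (2 * t)).neg).mul h1).congr_deriv ?_
  simp only [heatKD, heatKDD, zero_smul, add_zero, Pi.neg_apply]
  field_simp
  ring

lemma hasDerivAt_heatK {t : ℝ} (ht : 0 < t) (z : Eu n) :
    HasDerivAt (fun s => heatK s z) (∑ i, heatKDD i t z) t := by
  have h1 : HasDerivAt (fun s : ℝ => (4 * Real.pi * s) ^ (-(n / 2 : ℝ)))
      ((-(n / 2 : ℝ)) / t * (4 * Real.pi * t) ^ (-(n / 2 : ℝ))) t := by
    have h0 : 0 < 4 * Real.pi * t := by positivity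
    refine (((hasDerivAt_id t).const_mul (4 * Real.pi)).rpow_const
      (p := -(n / 2 : ℝ)) (Or.inl h0.ne')).congr_deriv ?_
    simp only [id]
    rw [Real.rpow_sub_one h0.ne']
    field_simp
  have h2 : HasDerivAt (fun s : ℝ => -‖z‖ ^ 2 / (4 * s)) (‖z‖ ^ 2 / (4 * t ^ 2)) t := by
    refine ((hasDerivAt_const t (-‖z‖ ^ 2)).div ((hasDerivAt_id t).const_mul 4)
      (by simpa using ht.ne')).congr_deriv ?_
    simp only [id]
    field_simp
    ring
  refine (h1.mul h2.exp).congr_deriv ?_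
  simp only [heatKDD, ← Finset.sum_mul, Finset.sum_sub_distrib, ← Finset.sum_div, heatK]
  rw [EuclideanSpace.norm_sq_eq z]
  simp only [Real.norm_eq_abs, sq_abs, Finset.sum_const, Finset.card_univ, Fintype.card_fin,
    nsmul_eq_mul]
  field_simp
  ring

lemma integral_heatK {t : ℝ} (ht : 0 < t) : ∫ z : Eu n, heatK t z = 1 := by
  unfold heatK
  rw [integral_const_mul]
  have h := GaussianFourier.integral_rexp_neg_mul_sq_norm (V := Eu n)
    (b := 1 / (4 * t)) (by positivity)
  have h2 : ∀ z : Eu n, -‖z‖ ^ 2 / (4 * t) = -(1 / (4 * t)) * ‖z‖ ^ 2 := fun z => by ring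
  simp_rw [h2]
  rw [h, finrank_euclideanSpace_fin, show Real.pi / (1 / (4 * t)) = 4 * Real.pi * t by field_simp,
    ← Real.rpow_add (by positivity)]
  simp

lemma integrable_heatK {t : ℝ} (ht : 0 < t) : Integrable (heatK (n := n) t) :=
  Integrable.of_integral_ne_zero (by rw [integral_heatK ht]; norm_num)

lemma heatK_le {t : ℝ} (ht : 0 < t) (z : Eu n) :
    heatK t z ≤ (4 * Real.pi * t) ^ (-(n / 2 : ℝ)) := by
  unfold heatK
  apply mul_le_of_le_one_right (by positivity)
  apply Real.exp_le_one_iff.2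
  apply div_nonpos_of_nonpos_of_nonneg <;> [simp; positivity]

lemma abs_heatKD_le (i : Fin n) {t : ℝ} (ht : 0 < t) (z : Eu n) :
    |heatKD i t z| ≤ (1 / (2 * t) * (1 + 8 * t) * 2 ^ (n / 2 : ℝ)) * heatK (2 * t) z := by
  have hz : |z i| ≤ (1 + 8 * t) * Real.exp (‖z‖ ^ 2 / (8 * t)) := by
    have h1 : |z i| ≤ ‖z‖ := by simpa using PiLp.norm_apply_le z i
    have h2 : ‖z‖ ^ 2 / (8 * t) + 1 ≤ Real.exp (‖z‖ ^ 2 / (8 * t)) := Real.add_one_le_exp _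
    have h3 : ‖z‖ ^ 2 ≤ 8 * t * Real.exp (‖z‖ ^ 2 / (8 * t)) := by
      have h4 : ‖z‖ ^ 2 / (8 * t) ≤ Real.exp (‖z‖ ^ 2 / (8 * t)) := by linarith
      rwa [div_le_iff₀' (by positivity)] at h4
    have h5 : 1 ≤ Real.exp (‖z‖ ^ 2 / (8 * t)) := Real.one_le_exp (by positivity)
    nlinarith [sq_nonneg (‖z‖ - 1)]
  have hk : Real.exp (‖z‖ ^ 2 / (8 * t)) * heatK t z = 2 ^ (n / 2 : ℝ) * heatK (2 * t) z := by
    unfold heatK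
    have e1 : (4 * Real.pi * (2 * t)) ^ (-(n / 2 : ℝ)) =
        (2 ^ (n / 2 : ℝ))⁻¹ * (4 * Real.pi * t) ^ (-(n / 2 : ℝ)) := by
      rw [← Real.rpow_neg (by norm_num), ← Real.mul_rpow (by norm_num) (by positivity)]
      congr 1; ring
    have e2 : Real.exp (-‖z‖ ^ 2 / (4 * (2 * t))) =
        Real.exp (‖z‖ ^ 2 / (8 * t)) * Real.exp (-‖z‖ ^ 2 / (4 * t)) := by
      rw [← Real.exp_add]; congr 1; field_simp; ring
    rw [e1, e2]
    field_simp
  unfold heatKD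
  rw [abs_mul, abs_neg, abs_div, abs_of_pos (show 0 < 2 * t by positivity),
    abs_of_pos (heatK_pos ht z)]
  calc |z i| / (2 * t) * heatK t z
      ≤ ((1 + 8 * t) * Real.exp (‖z‖ ^ 2 / (8 * t))) / (2 * t) * heatK t z := by
        gcongr; exact (heatK_pos ht z).le
    _ = 1 / (2 * t) * (1 + 8 * t) * (Real.exp (‖z‖ ^ 2 / (8 * t)) * heatK t z) := by ring
    _ = _ := by rw [hk]; ring

lemma integrable_heatKD (i : Fin n) {t : ℝ} (ht : 0 < t) : Integrable (heatKD i t) :=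
  ((integrable_heatK (show 0 < 2 * t by positivity)).const_mul _).mono'
    (continuous_heatKD i ht).aestronglyMeasurable
    (Filter.Eventually.of_forall fun z => abs_heatKD_le i ht z)

lemma integral_heatKD (i : Fin n) (t : ℝ) : ∫ z : Eu n, heatKD i t z = 0 := by
  have h : ∀ z : Eu n, heatKD i t (-z) = -heatKD i t z := fun z => by
    simp [heatKD, heatK_neg, neg_div]
  have h2 := integral_neg_eq_self (heatKD i t) (volume : Measure (Eu n))
  simp_rw [h, integral_neg] at h2
  linarith

/-- Product of two heat kernels, centred at the midpoint. -/
lemma heatK_mul_heatK {t : ℝ} (ht : 0 < t) (x y z : Eu n) :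
    heatK t (x - z) * heatK t (z - y) =
      heatK (2 * t) (x - y) * heatK (t / 2) (z - (1 / 2 : ℝ) • (x + y)) := by
  have hpar : ‖x - z‖ ^ 2 + ‖z - y‖ ^ 2 =
      2 * ‖z - (1 / 2 : ℝ) • (x + y)‖ ^ 2 + ‖x - y‖ ^ 2 / 2 := by
    have := parallelogram_law_with_norm ℝ (x - z) (z - y)
    have e1 : x - z + (z - y) = x - y := by abel
    have e2 : x - z - (z - y) = (-2 : ℝ) • (z - (1 / 2 : ℝ) • (x + y)) := by module
    rw [e1, e2, norm_smul] at this
    norm_num at this ⊢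
    nlinarith
  unfold heatK
  have e1 : (4 * Real.pi * t) ^ (-(n / 2 : ℝ)) * (4 * Real.pi * t) ^ (-(n / 2 : ℝ)) =
      (4 * Real.pi * (2 * t)) ^ (-(n / 2 : ℝ)) * (4 * Real.pi * (t / 2)) ^ (-(n / 2 : ℝ)) := by
    rw [← Real.mul_rpow (by positivity) (by positivity),
      ← Real.mul_rpow (by positivity) (by positivity)]
    congr 1; ring
  have e2 : Real.exp (-‖x - z‖ ^ 2 / (4 * t)) * Real.exp (-‖z - y‖ ^ 2 / (4 * t)) =
      Real.exp (-‖x - y‖ ^ 2 / (4 * (2 * t))) *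
        Real.exp (-‖z - (1 / 2 : ℝ) • (x + y)‖ ^ 2 / (4 * (t / 2))) := by
    rw [← Real.exp_add, ← Real.exp_add]
    congr 1
    field_simp
    linarith
  rw [mul_mul_mul_comm, e1, e2, mul_mul_mul_comm]

/-- Semigroup identity for the first derivative of the heat kernel. -/
lemma integral_heatK_mul_heatKD (i : Fin n) {t : ℝ} (ht : 0 < t) (x y : Eu n) :
    ∫ z, heatK t (x - z) * heatKD i t (z - y) = heatKD i (2 * t) (x - y) := by
  set m := (1 / 2 : ℝ) • (x + y) with hm
  have key : ∀ z, heatK t (x - z) * heatKD i t (z - y) =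
      heatK (2 * t) (x - y) * (1 / 2 * heatKD i (t / 2) (z - m) +
        -((x - y) i / (4 * t)) * heatK (t / 2) (z - m)) := by
    intro z
    have h1 : heatK t (x - z) * heatKD i t (z - y) =
      -((z - y) i / (2 * t)) * (heatK t (x - z) * heatK t (z - y)) := by unfold heatKD; ring
    rw [h1, heatK_mul_heatK ht, heatKD, ← hm]
    have h2 : (z - y) i = (z - m) i + (x - y) i / 2 := by
      simp [hm]; ring
    rw [h2]
    field_simp
    ring
  simp_rw [key]
  rw [integral_const_mul, integral_add, integral_const_mul, integral_const_mul,
    integral_sub_right_eq_self (heatKD i (t / 2)) m, integral_sub_right_eq_self (heatK (t / 2)) m,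
    integral_heatKD, integral_heatK (by positivity), heatKD]
  · field_simp; ring
  · exact ((integrable_heatKD i (by positivity)).comp_sub_right m).const_mul _
  · exact ((integrable_heatK (by positivity)).comp_sub_right m).const_mul _

/-! ### Heat extensions of continuous compactly supported functions -/

/-- Space convolution of a time-dependent kernel with a function. -/
def heatConv (κ : ℝ → Eu n → ℝ) (f : Eu n → ℝ) (t : ℝ) (x : Eu n) : ℝ := ∫ y, κ t (x - y) * f y

section HeatConv

variable {κ κ' : ℝ → Eu n → ℝ} {f : Eu n → ℝ}

lemma continuousOn_uncurry_heatConv (hf : Continuous f) (hfs : HasCompactSupport f)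
    (hκ : ContinuousOn (Function.uncurry κ) (Ioi 0 ×ˢ univ)) :
    ContinuousOn (Function.uncurry (heatConv κ f)) (Ioi 0 ×ˢ univ) := by
  refine continuousOn_integral_mul_of_hasCompactSupport (X := ℝ × Eu n)
    (b := fun s y => κ s.1 (s.2 - y)) hf hfs ?_
  exact hκ.comp (f := fun r : (ℝ × Eu n) × Eu n => (r.1.1, r.1.2 - r.2)) (by fun_prop)
    (fun r hr => ⟨hr.1.1, mem_univ _⟩)

lemma continuous_heatConv (hf : Continuous f) (hfs : HasCompactSupport f)
    (hκ : ContinuousOn (Function.uncurry κ) (Ioi 0 ×ˢ univ)) {t : ℝ} (ht : 0 < t) :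
    Continuous (heatConv κ f t) := by
  rw [← continuousOn_univ]
  exact (continuousOn_uncurry_heatConv hf hfs hκ).comp (f := fun x => (t, x)) (by fun_prop)
    fun x _ => ⟨ht, mem_univ _⟩

lemma hasDerivAt_heatConv (hf : Continuous f) (hfs : HasCompactSupport f)
    (hκ : ContinuousOn (Function.uncurry κ) (Ioi 0 ×ˢ univ))
    (hκ' : ContinuousOn (Function.uncurry κ') (Ioi 0 ×ˢ univ))
    (hd : ∀ t > 0, ∀ z, HasDerivAt (fun s => κ s z) (κ' t z) t) {t : ℝ} (ht : 0 < t) (x : Eu n) :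
    HasDerivAt (fun s => heatConv κ f s x) (heatConv κ' f t x) t := by
  have hc : ∀ {c : ℝ → Eu n → ℝ}, ContinuousOn (Function.uncurry c) (Ioi 0 ×ˢ univ) →
      ContinuousOn (Function.uncurry fun s y => c s (x - y)) (Ioi 0 ×ˢ univ) := fun h =>
    h.comp (f := fun r : ℝ × Eu n => (r.1, x - r.2)) (by fun_prop) (fun r hr => ⟨hr.1, mem_univ _⟩)
  exact hasDerivAt_integral_mul_of_hasCompactSupport hf hfs isOpen_Ioi (hc hκ) (hc hκ')
    (fun s hs y => hd s hs _) ht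

lemma hasLineDerivAt_heatConv (hf : Continuous f) (hfs : HasCompactSupport f)
    (hκ : ContinuousOn (Function.uncurry κ) (Ioi 0 ×ˢ univ))
    (hκ' : ContinuousOn (Function.uncurry κ') (Ioi 0 ×ˢ univ)) {v : Eu n}
    (hd : ∀ t > 0, ∀ z, HasLineDerivAt ℝ (κ t) (κ' t z) z v) {t : ℝ} (ht : 0 < t) (x : Eu n) :
    HasLineDerivAt ℝ (heatConv κ f t) (heatConv κ' f t x) x v := by
  have hc : ∀ {c : ℝ → Eu n → ℝ}, ContinuousOn (Function.uncurry c) (Ioi 0 ×ˢ univ) →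
      ContinuousOn (Function.uncurry fun (s : ℝ) y => c t (x + s • v - y)) (univ ×ˢ univ) :=
    fun h => h.comp (f := fun r : ℝ × Eu n => (t, x + r.1 • v - r.2)) (by fun_prop)
      (fun r hr => ⟨ht, mem_univ _⟩)
  have := hasDerivAt_integral_mul_of_hasCompactSupport hf hfs isOpen_univ (hc hκ) (hc hκ')
    (fun s _ y => ?_) (mem_univ 0)
  · simpa [HasLineDerivAt, heatConv] using this
  · have h0 := hd t ht (x + s • v - y)
    unfold HasLineDerivAt at h0
    have h1 : HasDerivAt (fun r : ℝ => r - s) 1 s := (hasDerivAt_id s).sub_const s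
    have h2 := HasDerivAt.scomp (h := fun r : ℝ => r - s) s (by simpa using h0) h1
    simp only [one_smul] at h2
    refine h2.congr_of_eventuallyEq (Filter.Eventually.of_forall fun r => ?_)
    simp only [Function.comp]
    congr 1
    module

lemma integrable_heatConv {t : ℝ} (hκ : Integrable (κ t)) (hf : Integrable f) :
    Integrable (heatConv κ f t) := by
  refine (Integrable.integrable_convolution (ContinuousLinearMap.mul ℝ ℝ) hf hκ).congr
    (Filter.Eventually.of_forall fun x => ?_)
  simp [convolution, heatConv, mul_comm]

lemma integral_heatConv {t : ℝ} (hκ : Integrable (κ t)) (hf : Integrable f) :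
    ∫ x, heatConv κ f t x = (∫ x, κ t x) * ∫ x, f x := by
  have := integral_convolution (ContinuousLinearMap.mul ℝ ℝ) hf hκ (μ := volume) (ν := volume)
  simp only [convolution, ContinuousLinearMap.mul_apply'] at this
  rw [mul_comm (∫ x, κ t x), ← this]
  simp [heatConv, mul_comm]

end HeatConv

section Positive

variable {f : Eu n → ℝ}

lemma heatConv_heatK_pos (hf : Continuous f) (hfs : HasCompactSupport f) (h0 : ∀ x, 0 ≤ f x)
    (hne : f ≠ 0) {t : ℝ} (ht : 0 < t) (x : Eu n) : 0 < heatConv heatK f t x := by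
  obtain ⟨y, hy⟩ := Function.ne_iff.1 hne
  refine Continuous.integral_pos_of_hasCompactSupport_nonneg_nonzero (x := y) ?_ hfs.mul_left
    (fun z => mul_nonneg (heatK_pos ht _).le (h0 z)) (mul_ne_zero (heatK_pos ht _).ne' hy)
  have := continuous_heatK (n := n) ht
  fun_prop

lemma rpow_tangent_le {p a s : ℝ} (hp : 1 ≤ p) (ha : 0 < a) (hs : 0 ≤ s) :
    a ^ p + p * a ^ (p - 1) * (s - a) ≤ s ^ p := by
  have h := one_add_mul_self_le_rpow_one_add (s := s / a - 1) (by
    have : 0 ≤ s / a := by positivity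
    linarith) hp
  rw [add_sub_cancel, Real.div_rpow hs ha.le, le_div_iff₀ (by positivity)] at h
  refine le_trans (le_of_eq ?_) h
  rw [Real.rpow_sub_one ha.ne']
  field_simp

lemma heatConv_rpow_le {p : ℝ} (hp : 1 ≤ p) (hf : Continuous f) (hfs : HasCompactSupport f)
    (h0 : ∀ x, 0 ≤ f x) (hne : f ≠ 0) {t : ℝ} (ht : 0 < t) (x : Eu n) :
    heatConv heatK f t x ^ p ≤ heatConv heatK (fun y => f y ^ p) t x := by
  set a := heatConv heatK f t x with ha
  have ha0 : 0 < a := heatConv_heatK_pos hf hfs h0 hne ht x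
  have hk : Continuous fun y => heatK t (x - y) :=
    (continuous_heatK ht).comp (continuous_const.sub continuous_id)
  have hki : Integrable fun y => heatK t (x - y) := (integrable_heatK ht).comp_sub_left x
  have hk1 : ∫ y, heatK t (x - y) = 1 := by
    rw [integral_sub_left_eq_self (heatK t) volume x, integral_heatK ht]
  have hfp : Continuous fun y => f y ^ p := hf.rpow_const fun y => Or.inr (by linarith)
  have hfps : HasCompactSupport fun y => f y ^ p :=
    hfs.comp_left (g := fun s : ℝ => s ^ p) (Real.zero_rpow (by linarith))
  have hi1 : Integrable fun y => heatK t (x - y) * f y :=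
    (hk.mul hf).integrable_of_hasCompactSupport hfs.mul_left
  have hi2 : Integrable fun y => heatK t (x - y) * f y ^ p :=
    (hk.mul hfp).integrable_of_hasCompactSupport hfps.mul_left
  have hi3 : Integrable fun y => heatK t (x - y) * f y - a * heatK t (x - y) :=
    hi1.sub (hki.const_mul a)
  have hexp : ∫ y, (a ^ p * heatK t (x - y) + p * a ^ (p - 1) *
      (heatK t (x - y) * f y - a * heatK t (x - y))) = a ^ p := by
    rw [integral_add (hki.const_mul _) (hi3.const_mul _),
      integral_const_mul, integral_const_mul, integral_sub hi1 (hki.const_mul _),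
      integral_const_mul, hk1]
    change _ + _ * (a - _) = _
    ring
  rw [← hexp]
  refine integral_mono ((hki.const_mul _).add (hi3.const_mul _)) hi2 fun y => ?_
  have := mul_le_mul_of_nonneg_left (rpow_tangent_le hp ha0 (h0 y)) (heatK_pos ht (x - y)).le
  dsimp only
  linarith

lemma heatConv_rpow_integrable {p : ℝ} (hp : 1 ≤ p) (hf : Continuous f)
    (hfs : HasCompactSupport f) (h0 : ∀ x, 0 ≤ f x) (hne : f ≠ 0) {t : ℝ} (ht : 0 < t) :
    Integrable (fun x => heatConv heatK f t x ^ p) ∧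
      ∫ x, heatConv heatK f t x ^ p ≤ ∫ x, f x ^ p := by
  have hfp : Continuous fun y => f y ^ p := hf.rpow_const fun y => Or.inr (by linarith)
  have hfps : HasCompactSupport fun y => f y ^ p :=
    hfs.comp_left (g := fun s : ℝ => s ^ p) (Real.zero_rpow (by linarith))
  have hfi := hfp.integrable_of_hasCompactSupport (μ := volume) hfps
  have hI := integrable_heatConv (integrable_heatK ht) hfi
  have hpos := heatConv_heatK_pos hf hfs h0 hne ht
  have hInt : Integrable (fun x => heatConv heatK f t x ^ p) := by
    refine hI.mono' ?_ (Filter.Eventually.of_forall fun x => ?_)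
    · exact ((continuous_heatConv hf hfs continuousOn_heatK ht).rpow_const
        fun x => Or.inr (by linarith)).aestronglyMeasurable
    · have := hpos x
      rw [Real.norm_of_nonneg (by positivity)]
      exact heatConv_rpow_le hp hf hfs h0 hne ht x
  refine ⟨hInt, (integral_mono hInt hI fun x => heatConv_rpow_le hp hf hfs h0 hne ht x).trans ?_⟩
  rw [integral_heatConv (integrable_heatK ht) hfi, integral_heatK ht, one_mul]

end Positive

lemma hasDerivAt_heatConv_heatK {f : Eu n → ℝ} (hf : Continuous f) (hfs : HasCompactSupport f)
    {t : ℝ} (ht : 0 < t) (x : Eu n) :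
    HasDerivAt (fun s => heatConv heatK f s x) (∑ i, heatConv (heatKDD i) f t x) t := by
  have h := hasDerivAt_heatConv (κ' := fun t z => ∑ i, heatKDD i t z) hf hfs continuousOn_heatK
    (by
      have := continuousOn_finsetSum Finset.univ fun i _ => continuousOn_heatKDD (n := n) i
      refine this.congr fun r _ => by simp [Function.uncurry])
    (fun t ht z => hasDerivAt_heatK ht z) ht x
  refine h.congr_deriv ?_
  unfold heatConv
  simp_rw [Finset.sum_mul]
  refine integral_finsetSum _ fun i _ => ?_
  refine Continuous.integrable_of_hasCompactSupport ?_ hfs.mul_left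
  refine Continuous.mul ?_ hf
  rw [← continuousOn_univ]
  exact (continuousOn_heatKDD i).comp (f := fun y => (t, x - y)) (by fun_prop)
    fun y _ => ⟨ht, mem_univ _⟩

/-- Integration by parts along a direction against a compactly supported factor. -/
lemma integral_lineDeriv_mul_eq_neg {a a' φ φ' : Eu n → ℝ} {v : Eu n} (ha : Continuous a)
    (ha' : Continuous a') (hφ : Continuous φ) (hφ' : Continuous φ') (hs : HasCompactSupport φ)
    (hs' : HasCompactSupport φ') (hd : ∀ x, HasLineDerivAt ℝ a (a' x) x v)
    (hdφ : ∀ x, HasLineDerivAt ℝ φ (φ' x) x v) :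
    ∫ x, a' x * φ x = -∫ x, a x * φ' x := by
  have := integral_bilinear_hasLineDerivAt_right_eq_neg_left_of_integrable
    (B := ContinuousLinearMap.mul ℝ ℝ) (μ := volume) (f := a) (f' := a') (g := φ) (g' := φ') (v := v)
    ((ha'.mul hφ).integrable_of_hasCompactSupport hs.mul_left)
    ((ha.mul hφ').integrable_of_hasCompactSupport hs'.mul_left)
    ((ha.mul hφ).integrable_of_hasCompactSupport hs.mul_left)
    (fun x _ => hd x) (fun x _ => hdφ x)
  simp only [ContinuousLinearMap.mul_apply'] at this
  linarith

/-! ### Partial derivatives and cutoff functions -/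

/-- The partial derivative in the direction of the `i`-th coordinate. -/
def partialD (i : Fin n) (f : Eu n → ℝ) (x : Eu n) : ℝ :=
  fderiv ℝ f x (EuclideanSpace.single i 1)

section PartialD

variable {f g : Eu n → ℝ}

lemma contDiff_partialD (hf : ContDiff ℝ (⊤ : ℕ∞) f) (i : Fin n) :
    ContDiff ℝ (⊤ : ℕ∞) (partialD i f) :=
  (hf.fderiv_right (m := (⊤ : ℕ∞)) (by simp)).clm_apply contDiff_const

lemma hasCompactSupport_partialD (hf : HasCompactSupport f) (i : Fin n) :
    HasCompactSupport (partialD i f) :=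
  hf.fderiv_apply (𝕜 := ℝ) _

lemma hasLineDerivAt_partialD (hf : ContDiff ℝ (⊤ : ℕ∞) f) (i : Fin n) (x : Eu n) :
    HasLineDerivAt ℝ f (partialD i f x) x (EuclideanSpace.single i 1) :=
  ((hf.differentiable (by simp) x).hasFDerivAt).hasLineDerivAt _

lemma partialD_comm (hf : ContDiff ℝ (⊤ : ℕ∞) f) (i j : Fin n) (x : Eu n) :
    partialD i (partialD j f) x = partialD j (partialD i f) x := by
  have hd : DifferentiableAt ℝ (fderiv ℝ f) x :=
    (hf.fderiv_right (m := (⊤ : ℕ∞)) (by simp)).differentiable (by simp) x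
  have key : ∀ a b : Fin n, partialD a (partialD b f) x =
      fderiv ℝ (fderiv ℝ f) x (EuclideanSpace.single a 1) (EuclideanSpace.single b 1) := by
    intro a b
    unfold partialD
    rw [fderiv_clm_apply hd (differentiableAt_const _)]
    simp
  rw [key, key]
  exact (hf.contDiffAt.isSymmSndFDerivAt (by simpa using WithTop.coe_le_coe.2 (le_top : (2 : ℕ∞) ≤ ⊤))) _ _

lemma partialD_comp_smul (hf : ContDiff ℝ (⊤ : ℕ∞) f) (i : Fin n) (c : ℝ) :
    partialD i (fun x => f (c • x)) = fun x => c * partialD i f (c • x) := by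
  ext x
  unfold partialD
  have h := (hf.differentiable (by simp) (c • x)).hasFDerivAt.comp x
    ((hasFDerivAt_id x).const_smul c)
  have h2 : HasFDerivAt (fun x => f (c • x)) _ x := h
  rw [h2.fderiv]
  simp

lemma partialD_const_mul (hf : ContDiff ℝ (⊤ : ℕ∞) f) (i : Fin n) (c : ℝ) :
    partialD i (fun x => c * f x) = fun x => c * partialD i f x := by
  ext x
  unfold partialD
  rw [fderiv_const_mul (hf.differentiable (by simp) x)]
  simp

end PartialD

lemma exists_cutoff (n : ℕ) (m δ : ℝ) (hδ : 0 < δ) :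
    ∃ φ : Eu n → ℝ, ContDiff ℝ (⊤ : ℕ∞) φ ∧ HasCompactSupport φ ∧ (∀ x, 0 ≤ φ x) ∧
      (∀ x, φ x ≤ 1) ∧ (∀ x ∈ closedBall (0 : Eu n) m, φ x = 1) ∧
      ∀ x, ∑ i, |partialD i (partialD i φ) x| ≤ δ := by
  let ψ : ContDiffBump (0 : Eu n) := ⟨1, 2, one_pos, one_lt_two⟩
  have hψ : ContDiff ℝ (⊤ : ℕ∞) (ψ : Eu n → ℝ) := ψ.contDiff
  have hψs : HasCompactSupport (ψ : Eu n → ℝ) := ψ.hasCompactSupport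
  obtain ⟨C, hC⟩ : ∃ C, ∀ x, ‖∑ i, |partialD i (partialD i (ψ : Eu n → ℝ)) x|‖ ≤ C := by
    refine Continuous.bounded_above_of_compact_support (f := fun x =>
      ∑ i, |partialD i (partialD i (ψ : Eu n → ℝ)) x|) ?_ ?_
    · exact continuous_finsetSum _ fun i _ =>
        (contDiff_partialD (contDiff_partialD hψ i) i).continuous.abs
    · refine HasCompactSupport.of_support_subset_isCompact hψs ?_
      intro x hx
      by_contra hx'
      refine hx (Finset.sum_eq_zero fun i _ => ?_)
      rw [abs_eq_zero]
      refine image_eq_zero_of_notMem_tsupport fun h => hx' ?_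
      exact (tsupport_fderiv_apply_subset ℝ _ |>.trans (tsupport_fderiv_apply_subset ℝ _)) h
  have hC0 : 0 ≤ C := (norm_nonneg _).trans (hC 0)
  set R : ℝ := max 1 (max m (C / δ)) with hR
  have hR1 : 1 ≤ R := le_max_left _ _
  have hR0 : 0 < R := by linarith
  have hRm : m ≤ R := (le_max_left _ _).trans (le_max_right _ _)
  have hRC : C / δ ≤ R := (le_max_right _ _).trans (le_max_right _ _)
  refine ⟨fun x => ψ (R⁻¹ • x), hψ.comp (contDiff_const_smul _),
    hψs.comp_smul (inv_ne_zero hR0.ne'), fun x => ψ.nonneg, fun x => ψ.le_one, ?_, ?_⟩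
  · intro x hx
    refine ψ.one_of_mem_closedBall ?_
    rw [mem_closedBall_zero_iff] at hx ⊢
    rw [norm_smul, Real.norm_of_nonneg (by positivity), inv_mul_le_iff₀ hR0]
    simp only [ψ, mul_one]
    linarith
  · intro x
    have h2 : ∀ i, partialD i (partialD i fun x => ψ (R⁻¹ • x)) x =
        R⁻¹ * (R⁻¹ * partialD i (partialD i (ψ : Eu n → ℝ)) (R⁻¹ • x)) := by
      intro i
      have h := (contDiff_partialD hψ i).comp (contDiff_const_smul R⁻¹)
      rw [partialD_comp_smul hψ, partialD_const_mul (f := fun x => partialD i ψ (R⁻¹ • x)) h,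
        partialD_comp_smul (contDiff_partialD hψ i)]
    simp_rw [h2, abs_mul, ← Finset.mul_sum]
    have h3 := (le_abs_self _).trans (hC (R⁻¹ • x))
    have h4 : |R⁻¹| = R⁻¹ := abs_of_pos (by positivity)
    rw [h4]
    calc _ ≤ R⁻¹ * (1 * C) := by
          gcongr
          · exact inv_le_one_of_one_le₀ hR1
      _ ≤ δ := by
          rw [one_mul, inv_mul_le_iff₀ hR0]
          rwa [div_le_iff₀ hδ] at hRC

/-! ### Continuity of the Bellman function along positive curves -/

section BellmanContinuous

variable {X : Type*} [TopologicalSpace X] {s : Set X} {a b a₁ b₁ : X → ℝ} {p q K : ℝ}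

set_option maxHeartbeats 1600000 in
lemma ContinuousOn.bellman (ha : ContinuousOn a s) (hb : ContinuousOn b s)
    (ha0 : ∀ x ∈ s, 0 < a x) (hb0 : ∀ x ∈ s, 0 < b x) :
    ContinuousOn (fun x => bellman p q K (a x) (b x)) s ∧
    ContinuousOn (fun x => bellmanU p q (a x) (b x)) s ∧
    ContinuousOn (fun x => bellmanV p q K (a x) (b x)) s ∧
    ContinuousOn (fun x => bellmanUU p q (a x) (b x)) s ∧
    ContinuousOn (fun x => bellmanUV p q (a x) (b x)) s ∧
    ContinuousOn (fun x => bellmanVV p q K (a x) (b x)) s := by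
  have hA : ∀ r : ℝ, ContinuousOn (fun x => a x ^ r) s := fun r =>
    ha.rpow_const fun x hx => Or.inl (ha0 x hx).ne'
  have hB : ∀ r : ℝ, ContinuousOn (fun x => b x ^ r) s := fun r =>
    hb.rpow_const fun x hx => Or.inl (hb0 x hx).ne'
  have hW : ∀ r : ℝ, ContinuousOn (fun x => bellmanW p q (a x) (b x) ^ r) s := fun r =>
    ContinuousOn.rpow_const ((hA p).add (hB q)) fun x hx =>
      Or.inl (bellmanW_pos (ha0 x hx) (hb0 x hx)).ne'
  have hA1 := hA (p - 1)
  have hA2 := hA (p - 2)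
  have hBq := hB q
  have hB1 := hB (q - 1)
  have hB2 := hB (q - 2)
  have hW0 := hW (1 - 2 / p)
  have hW1 := hW (1 - 2 / p - 1)
  have hW2 := hW (1 - 2 / p - 2)
  unfold _root_.bellman bellmanU bellmanV bellmanUU bellmanUV bellmanVV
  refine ⟨?_, ?_, ?_, ?_, ?_, ?_⟩ <;> fun_prop

lemma ContinuousOn.bellmanHess (ha : ContinuousOn a s) (hb : ContinuousOn b s)
    (ha0 : ∀ x ∈ s, 0 < a x) (hb0 : ∀ x ∈ s, 0 < b x) (ha₁ : ContinuousOn a₁ s)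
    (hb₁ : ContinuousOn b₁ s) :
    ContinuousOn (fun x => bellmanHess p q K (a x) (b x) (a₁ x) (b₁ x)) s := by
  obtain ⟨-, -, -, h1, h2, h3⟩ := ha.bellman (p := p) (q := q) (K := K) hb ha0 hb0
  unfold _root_.bellmanHess
  fun_prop

end BellmanContinuous

/-! ### The Bellman function along the heat flow -/

/-- Nonzero nonnegative continuous functions of compact support. -/
structure IsPosTest (f : Eu n → ℝ) : Prop where
  cont : Continuous f
  supp : HasCompactSupport f
  nonneg : ∀ x, 0 ≤ f x
  ne_zero : f ≠ 0

/-- The Bellman function evaluated along a pair of heat extensions. -/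
def bellmanFlow (p q : ℝ) (f g : Eu n → ℝ) (t : ℝ) (x : Eu n) : ℝ :=
  bellman p q (bellmanK q) (heatConv heatK f t x) (heatConv heatK g t x)

/-- The `i`-th spatial derivative of `bellmanFlow`. -/
def bellmanFlowD (p q : ℝ) (f g : Eu n → ℝ) (i : Fin n) (t : ℝ) (x : Eu n) : ℝ :=
  bellmanU p q (heatConv heatK f t x) (heatConv heatK g t x) * heatConv (heatKD i) f t x +
    bellmanV p q (bellmanK q) (heatConv heatK f t x) (heatConv heatK g t x) *
      heatConv (heatKD i) g t x

/-- The contribution of the `i`-th second derivatives of the heat extensions. -/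
def bellmanFlowDD (p q : ℝ) (f g : Eu n → ℝ) (i : Fin n) (t : ℝ) (x : Eu n) : ℝ :=
  bellmanU p q (heatConv heatK f t x) (heatConv heatK g t x) * heatConv (heatKDD i) f t x +
    bellmanV p q (bellmanK q) (heatConv heatK f t x) (heatConv heatK g t x) *
      heatConv (heatKDD i) g t x

/-- The Hessian form of the Bellman function on the `i`-th derivatives of the heat extensions. -/
def bellmanFlowHess (p q : ℝ) (f g : Eu n → ℝ) (i : Fin n) (t : ℝ) (x : Eu n) : ℝ :=
  bellmanHess p q (bellmanK q) (heatConv heatK f t x) (heatConv heatK g t x)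
    (heatConv (heatKD i) f t x) (heatConv (heatKD i) g t x)

lemma continuous_slice {c : ℝ → Eu n → ℝ}
    (hc : ContinuousOn (Function.uncurry c) (Ioi 0 ×ˢ univ)) {t : ℝ} (ht : 0 < t) :
    Continuous (c t) := by
  rw [← continuousOn_univ]
  exact hc.comp (f := fun x => (t, x)) (by fun_prop) fun x _ => ⟨ht, mem_univ _⟩

section Flow

variable {p q : ℝ} {f g : Eu n → ℝ}

lemma IsPosTest.heat_pos (hf : IsPosTest f) {t : ℝ} (ht : 0 < t) (x : Eu n) :
    0 < heatConv heatK f t x :=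
  heatConv_heatK_pos hf.cont hf.supp hf.nonneg hf.ne_zero ht x

lemma continuousOn_bellmanFlow (hf : IsPosTest f) (hg : IsPosTest g) :
    ContinuousOn (Function.uncurry (bellmanFlow p q f g)) (Ioi 0 ×ˢ univ) :=
  ((continuousOn_uncurry_heatConv hf.cont hf.supp continuousOn_heatK).bellman
    (continuousOn_uncurry_heatConv hg.cont hg.supp continuousOn_heatK)
    (fun _ hr => hf.heat_pos hr.1 _) (fun _ hr => hg.heat_pos hr.1 _)).1

lemma continuousOn_bellmanFlowD (hf : IsPosTest f) (hg : IsPosTest g) (i : Fin n) :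
    ContinuousOn (Function.uncurry (bellmanFlowD p q f g i)) (Ioi 0 ×ˢ univ) := by
  obtain ⟨-, h1, h2, -⟩ :=
    (continuousOn_uncurry_heatConv hf.cont hf.supp continuousOn_heatK).bellman (p := p) (q := q)
    (K := bellmanK q) (continuousOn_uncurry_heatConv hg.cont hg.supp continuousOn_heatK)
    (fun _ hr => hf.heat_pos hr.1 _) (fun _ hr => hg.heat_pos hr.1 _)
  exact (h1.mul (continuousOn_uncurry_heatConv hf.cont hf.supp (continuousOn_heatKD i))).add
    (h2.mul (continuousOn_uncurry_heatConv hg.cont hg.supp (continuousOn_heatKD i)))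

lemma continuousOn_bellmanFlowDD (hf : IsPosTest f) (hg : IsPosTest g) (i : Fin n) :
    ContinuousOn (Function.uncurry (bellmanFlowDD p q f g i)) (Ioi 0 ×ˢ univ) := by
  obtain ⟨-, h1, h2, -⟩ :=
    (continuousOn_uncurry_heatConv hf.cont hf.supp continuousOn_heatK).bellman (p := p) (q := q)
    (K := bellmanK q) (continuousOn_uncurry_heatConv hg.cont hg.supp continuousOn_heatK)
    (fun _ hr => hf.heat_pos hr.1 _) (fun _ hr => hg.heat_pos hr.1 _)
  exact (h1.mul (continuousOn_uncurry_heatConv hf.cont hf.supp (continuousOn_heatKDD i))).add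
    (h2.mul (continuousOn_uncurry_heatConv hg.cont hg.supp (continuousOn_heatKDD i)))

lemma continuousOn_bellmanFlowHess (hf : IsPosTest f) (hg : IsPosTest g) (i : Fin n) :
    ContinuousOn (Function.uncurry (bellmanFlowHess p q f g i)) (Ioi 0 ×ˢ univ) :=
  (continuousOn_uncurry_heatConv hf.cont hf.supp continuousOn_heatK).bellmanHess
    (continuousOn_uncurry_heatConv hg.cont hg.supp continuousOn_heatK)
    (fun _ hr => hf.heat_pos hr.1 _) (fun _ hr => hg.heat_pos hr.1 _)
    (continuousOn_uncurry_heatConv hf.cont hf.supp (continuousOn_heatKD i))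
    (continuousOn_uncurry_heatConv hg.cont hg.supp (continuousOn_heatKD i))

lemma hasDerivAt_bellmanFlow (hf : IsPosTest f) (hg : IsPosTest g) {t : ℝ} (ht : 0 < t)
    (x : Eu n) :
    HasDerivAt (fun s => bellmanFlow p q f g s x) (∑ i, bellmanFlowDD p q f g i t x) t := by
  refine ((hasDerivAt_heatConv_heatK hf.cont hf.supp ht x).bellman
    (hasDerivAt_heatConv_heatK hg.cont hg.supp ht x) (hf.heat_pos ht x)
    (hg.heat_pos ht x)).congr_deriv ?_
  simp only [bellmanFlowDD, Finset.sum_add_distrib, Finset.mul_sum]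

lemma hasLineDerivAt_bellmanFlow (hf : IsPosTest f) (hg : IsPosTest g) (i : Fin n) {t : ℝ}
    (ht : 0 < t) (x : Eu n) :
    HasLineDerivAt ℝ (bellmanFlow p q f g t) (bellmanFlowD p q f g i t x) x
      (EuclideanSpace.single i 1) := by
  have h := HasDerivAt.bellman (p := p) (q := q) (K := bellmanK q)
    (hasLineDerivAt_heatConv hf.cont hf.supp continuousOn_heatK (continuousOn_heatKD i)
      (fun t ht z => hasLineDerivAt_heatK i ht z) ht x)
    (hasLineDerivAt_heatConv hg.cont hg.supp continuousOn_heatK (continuousOn_heatKD i)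
      (fun t ht z => hasLineDerivAt_heatK i ht z) ht x) (hf.heat_pos ht _) (hg.heat_pos ht _)
  rw [zero_smul, add_zero] at h
  exact h

lemma hasLineDerivAt_bellmanFlowD (hf : IsPosTest f) (hg : IsPosTest g) (i : Fin n) {t : ℝ}
    (ht : 0 < t) (x : Eu n) :
    HasLineDerivAt ℝ (bellmanFlowD p q f g i t)
      (bellmanFlowHess p q f g i t x + bellmanFlowDD p q f g i t x) x
      (EuclideanSpace.single i 1) := by
  have hF := hasLineDerivAt_heatConv hf.cont hf.supp continuousOn_heatK (continuousOn_heatKD i)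
      (fun t ht z => hasLineDerivAt_heatK i ht z) ht x
  have hG := hasLineDerivAt_heatConv hg.cont hg.supp continuousOn_heatK (continuousOn_heatKD i)
      (fun t ht z => hasLineDerivAt_heatK i ht z) ht x
  have hF1 := hasLineDerivAt_heatConv hf.cont hf.supp (continuousOn_heatKD i)
    (continuousOn_heatKDD i) (fun t ht z => hasLineDerivAt_heatKD i ht z) ht x
  have hG1 := hasLineDerivAt_heatConv hg.cont hg.supp (continuousOn_heatKD i)
    (continuousOn_heatKDD i) (fun t ht z => hasLineDerivAt_heatKD i ht z) ht x
  have hU := HasDerivAt.bellmanU (p := p) (q := q) hF hG (hf.heat_pos ht _) (hg.heat_pos ht _)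
  have hV := HasDerivAt.bellmanV (p := p) (q := q) (K := bellmanK q) hF hG (hf.heat_pos ht _)
    (hg.heat_pos ht _)
  have h := (HasDerivAt.mul hU hF1).add (HasDerivAt.mul hV hG1)
  simp only [zero_smul, add_zero] at h
  refine HasDerivAt.congr_deriv h ?_
  simp only [bellmanFlowHess, bellmanFlowDD, bellmanHess]
  ring

lemma integral_bellmanFlowDD_mul (hf : IsPosTest f) (hg : IsPosTest g) (i : Fin n) {t : ℝ}
    (ht : 0 < t) {φ : Eu n → ℝ} (hφ : ContDiff ℝ (⊤ : ℕ∞) φ) (hφs : HasCompactSupport φ) :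
    ∫ x, bellmanFlowDD p q f g i t x * φ x =
      (∫ x, bellmanFlow p q f g t x * partialD i (partialD i φ) x) -
        ∫ x, bellmanFlowHess p q f g i t x * φ x := by
  have c0 := continuous_slice (continuousOn_bellmanFlow (p := p) (q := q) hf hg) ht
  have c1 := continuous_slice (continuousOn_bellmanFlowD (p := p) (q := q) hf hg i) ht
  have c2 := continuous_slice (continuousOn_bellmanFlowDD (p := p) (q := q) hf hg i) ht
  have cH := continuous_slice (continuousOn_bellmanFlowHess (p := p) (q := q) hf hg i) ht
  have hφ1 := contDiff_partialD hφ i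
  have hφ2 := contDiff_partialD hφ1 i
  have hs1 := hasCompactSupport_partialD hφs i
  have hs2 := hasCompactSupport_partialD hs1 i
  have e1 := integral_lineDeriv_mul_eq_neg c1 (cH.add c2) hφ.continuous hφ1.continuous hφs hs1
    (hasLineDerivAt_bellmanFlowD hf hg i ht) (hasLineDerivAt_partialD hφ i)
  have e2 := integral_lineDeriv_mul_eq_neg c0 c1 hφ1.continuous hφ2.continuous hs1 hs2
    (hasLineDerivAt_bellmanFlow hf hg i ht) (hasLineDerivAt_partialD hφ1 i)
  simp only [Pi.add_apply, add_mul] at e1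
  have iH : Integrable fun x => bellmanFlowHess p q f g i t x * φ x :=
    (cH.mul hφ.continuous).integrable_of_hasCompactSupport hφs.mul_left
  have i2 : Integrable fun x => bellmanFlowDD p q f g i t x * φ x :=
    (c2.mul hφ.continuous).integrable_of_hasCompactSupport hφs.mul_left
  rw [integral_add iH i2] at e1
  linarith

lemma hasDerivAt_integral_bellmanFlow_mul (hf : IsPosTest f) (hg : IsPosTest g) {t : ℝ}
    (ht : 0 < t) {φ : Eu n → ℝ} (hφ : ContDiff ℝ (⊤ : ℕ∞) φ) (hφs : HasCompactSupport φ) :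
    HasDerivAt (fun s => ∫ x, bellmanFlow p q f g s x * φ x)
      ((∫ x, bellmanFlow p q f g t x * ∑ i, partialD i (partialD i φ) x) -
        ∫ x, (∑ i, bellmanFlowHess p q f g i t x) * φ x) t := by
  refine (hasDerivAt_integral_mul_of_hasCompactSupport hφ.continuous hφs isOpen_Ioi
    (continuousOn_bellmanFlow hf hg) (b' := fun s x => ∑ i, bellmanFlowDD p q f g i s x) ?_
    (fun s hs y => hasDerivAt_bellmanFlow hf hg hs y) ht).congr_deriv ?_
  · refine (continuousOn_finsetSum Finset.univ fun i _ =>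
      continuousOn_bellmanFlowDD (p := p) (q := q) hf hg i).congr fun r _ => ?_
    simp [Function.uncurry]
  · simp_rw [Finset.sum_mul, Finset.mul_sum]
    have hc := hφ.continuous
    rw [integral_finsetSum, integral_finsetSum, integral_finsetSum, ← Finset.sum_sub_distrib]
    · exact Finset.sum_congr rfl fun i _ => integral_bellmanFlowDD_mul hf hg i ht hφ hφs
    · exact fun i _ => ((continuous_slice (continuousOn_bellmanFlowHess hf hg i) ht).mul
        hc).integrable_of_hasCompactSupport hφs.mul_left
    · exact fun i _ => ((continuous_slice (continuousOn_bellmanFlow hf hg) ht).mul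
        (contDiff_partialD (contDiff_partialD hφ i) i).continuous).integrable_of_hasCompactSupport
          (hasCompactSupport_partialD (hasCompactSupport_partialD hφs i) i).mul_left
    · exact fun i _ => ((continuous_slice (continuousOn_bellmanFlowDD hf hg i) ht).mul
        hc).integrable_of_hasCompactSupport hφs.mul_left

lemma bellmanFlow_nonneg (hq : 1 < q) (hf : IsPosTest f) (hg : IsPosTest g) {t : ℝ}
    (ht : 0 < t) (x : Eu n) : 0 ≤ bellmanFlow p q f g t x :=
  bellman_nonneg hq (hf.heat_pos ht x) (hg.heat_pos ht x)

lemma bellmanFlow_integrable (hp : 2 ≤ p) (hq : 1 < q) (hf : IsPosTest f) (hg : IsPosTest g)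
    {t : ℝ} (ht : 0 < t) : Integrable (bellmanFlow p q f g t) ∧
      ∫ x, bellmanFlow p q f g t x ≤ (bellmanK q + 1) * ((∫ x, f x ^ p) + ∫ x, g x ^ q) := by
  have hK : 0 < bellmanK q := by
    have : 0 < q - 1 := by linarith
    unfold bellmanK; positivity
  obtain ⟨hF, hF'⟩ := heatConv_rpow_integrable (p := p) (by linarith) hf.cont hf.supp hf.nonneg
    hf.ne_zero ht
  obtain ⟨hG, hG'⟩ := heatConv_rpow_integrable hq.le hg.cont hg.supp hg.nonneg hg.ne_zero ht
  have hle := fun x => bellman_le hp hq (hf.heat_pos ht x) (hg.heat_pos ht x)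
  have hInt : Integrable (bellmanFlow p q f g t) := by
    refine ((hF.add hG).const_mul (bellmanK q + 1)).mono'
      (continuous_slice (continuousOn_bellmanFlow hf hg) ht).aestronglyMeasurable
      (Filter.Eventually.of_forall fun x => ?_)
    rw [Real.norm_of_nonneg (bellmanFlow_nonneg hq hf hg ht x)]
    exact hle x
  refine ⟨hInt, (integral_mono hInt ((hF.add hG).const_mul (bellmanK q + 1)) hle).trans ?_⟩
  rw [integral_const_mul]
  refine mul_le_mul_of_nonneg_left ?_ (by linarith)
  rw [integral_add' hF hG]
  exact add_le_add hF' hG'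

end Flow

/-! ### The bilinear embedding -/

section Embedding

variable {p q : ℝ} {f g : Eu n → ℝ}

lemma integral_bellmanFlowHess_le (hp : 2 ≤ p) (hq : 1 < q) (hf : IsPosTest f)
    (hg : IsPosTest g) {ε T δ : ℝ} (hε : 0 < ε) (hεT : ε ≤ T) {φ : Eu n → ℝ}
    (hφ : ContDiff ℝ (⊤ : ℕ∞) φ) (hφs : HasCompactSupport φ) (hφ0 : ∀ x, 0 ≤ φ x)
    (hφ1 : ∀ x, φ x ≤ 1) (hφδ : ∀ x, ∑ i, |partialD i (partialD i φ) x| ≤ δ) :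
    ∫ t in ε..T, ∫ x, (∑ i, bellmanFlowHess p q f g i t x) * φ x ≤
      (bellmanK q + 1) * ((∫ x, f x ^ p) + ∫ x, g x ^ q) * (1 + δ * (T - ε)) := by
  set M := (bellmanK q + 1) * ((∫ x, f x ^ p) + ∫ x, g x ^ q) with hM
  set Φ : ℝ → ℝ := fun s => ∫ x, bellmanFlow p q f g s x * φ x with hΦ
  have hδ : 0 ≤ δ := (Finset.sum_nonneg fun i _ => abs_nonneg _).trans (hφδ 0)
  have hΦd := fun t (ht : 0 < t) =>
    hasDerivAt_integral_bellmanFlow_mul (p := p) (q := q) hf hg ht hφ hφs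
  have hInt := fun t (ht : 0 < t) => bellmanFlow_integrable hp hq hf hg ht
  have hnn := fun t (ht : 0 < t) => bellmanFlow_nonneg (p := p) hq hf hg ht
  have hΦ0 : 0 ≤ Φ T :=
    integral_nonneg fun x => mul_nonneg (hnn T (hε.trans_le hεT) x) (hφ0 x)
  have hΦ1 : Φ ε ≤ M := by
    refine le_trans (integral_mono ?_ (hInt ε hε).1 fun x => ?_) (hInt ε hε).2
    · exact ((continuous_slice (continuousOn_bellmanFlow hf hg) hε).mul
        hφ.continuous).integrable_of_hasCompactSupport hφs.mul_left
    · exact mul_le_of_le_one_right (hnn ε hε x) (hφ1 x)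
  have hL : ∀ t > 0, ∫ x, bellmanFlow p q f g t x * ∑ i, partialD i (partialD i φ) x ≤ δ * M := by
    intro t ht
    have hb : ∀ x, |∑ i, partialD i (partialD i φ) x| ≤ δ := fun x =>
      (Finset.abs_sum_le_sum_abs _ _).trans (hφδ x)
    have h1 : ∫ x, bellmanFlow p q f g t x * ∑ i, partialD i (partialD i φ) x ≤
        ∫ x, δ * bellmanFlow p q f g t x := by
      refine integral_mono (((hInt t ht).1.const_mul δ).mono' ?_
        (Filter.Eventually.of_forall fun x => ?_)) ((hInt t ht).1.const_mul δ) fun x => ?_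
      · refine Continuous.aestronglyMeasurable
          ((continuous_slice (continuousOn_bellmanFlow hf hg) ht).mul ?_)
        exact continuous_finsetSum _ fun i _ =>
          (contDiff_partialD (contDiff_partialD hφ i) i).continuous
      · rw [norm_mul, Real.norm_of_nonneg (hnn t ht x), mul_comm]
        exact mul_le_mul_of_nonneg_right (hb x) (hnn t ht x)
      · dsimp only
        rw [mul_comm]
        exact mul_le_mul_of_nonneg_right ((le_abs_self _).trans (hb x)) (hnn t ht x)
    refine h1.trans ?_
    rw [integral_const_mul]
    exact mul_le_mul_of_nonneg_left (hInt t ht).2 hδ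
  have hpos : ∀ {t}, t ∈ Icc ε T → 0 < t := fun ht => hε.trans_le ht.1
  have key := intervalIntegral.integral_le_sub_of_hasDeriv_right_of_le
    (g := fun t => δ * M * t - Φ t) (φ := fun t => ∫ x, (∑ i, bellmanFlowHess p q f g i t x) * φ x)
    (g' := fun t => δ * M - ((∫ x, bellmanFlow p q f g t x * ∑ i, partialD i (partialD i φ) x) -
        ∫ x, (∑ i, bellmanFlowHess p q f g i t x) * φ x)) hεT ?_ ?_ ?_ ?_
  · linarith
  · intro t ht
    exact (((hasDerivAt_id t).const_mul (δ * M)).continuousAt.sub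
      (hΦd t (hpos ht)).continuousAt).continuousWithinAt
  · intro t ht
    have := (((hasDerivAt_id t).const_mul (δ * M)).sub (hΦd t (hε.trans ht.1))).hasDerivWithinAt
      (s := Ioi t)
    rw [mul_one] at this
    exact this
  · refine ContinuousOn.integrableOn_Icc (ContinuousOn.mono
      (continuousOn_integral_mul_of_hasCompactSupport hφ.continuous hφs (U := Ioi 0)
        (b := fun t x => ∑ i, bellmanFlowHess p q f g i t x) ?_) fun t ht => hpos ht)
    refine (continuousOn_finsetSum Finset.univ fun i _ =>
      continuousOn_bellmanFlowHess (p := p) (q := q) hf hg i).congr fun r _ => ?_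
    simp [Function.uncurry]
  · intro t ht
    have := hL t (hε.trans ht.1)
    linarith

lemma two_mul_abs_mul_abs_le_sum_bellmanFlowHess (hpq : p.HolderConjugate q) (hp : 2 ≤ p)
    (hf : IsPosTest f) (hg : IsPosTest g) (k j : Fin n) {t : ℝ} (ht : 0 < t) (x : Eu n) :
    2 * (|heatConv (heatKD k) f t x| * |heatConv (heatKD j) g t x|) ≤
      ∑ i, bellmanFlowHess p q f g i t x := by
  have hu := hf.heat_pos ht x
  have hv := hg.heat_pos ht x
  set c := bellmanW p q (heatConv heatK f t x) (heatConv heatK g t x) ^ (1 - 2 / p)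
  have hc : 0 < c := Real.rpow_pos_of_pos (bellmanW_pos hu hv) _
  set a := heatConv (heatKD k) f t x with ha
  set b := heatConv (heatKD j) g t x with hb
  have h1 : c * a ^ 2 ≤ ∑ i, c * heatConv (heatKD i) f t x ^ 2 :=
    Finset.single_le_sum (f := fun i => c * heatConv (heatKD i) f t x ^ 2)
      (fun i _ => by positivity) (Finset.mem_univ k)
  have h2 : c⁻¹ * b ^ 2 ≤ ∑ i, c⁻¹ * heatConv (heatKD i) g t x ^ 2 :=
    Finset.single_le_sum (f := fun i => c⁻¹ * heatConv (heatKD i) g t x ^ 2)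
      (fun i _ => by positivity) (Finset.mem_univ j)
  have h3 : 2 * (|a| * |b|) ≤ c * a ^ 2 + c⁻¹ * b ^ 2 := by
    rw [← sq_abs a, ← sq_abs b]
    have := mul_nonneg (inv_pos.2 hc).le (sq_nonneg (c * |a| - |b|))
    have e : c⁻¹ * (c * |a| - |b|) ^ 2 = c * |a| ^ 2 - 2 * (|a| * |b|) + c⁻¹ * |b| ^ 2 := by
      field_simp
      ring
    linarith
  refine h3.trans ((add_le_add h1 h2).trans ?_)
  rw [← Finset.sum_add_distrib]
  exact Finset.sum_le_sum fun i _ => bellmanHess_ge hpq hp hu hv _ _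

lemma lintegral_closedBall_mul_le (hpq : p.HolderConjugate q) (hp : 2 ≤ p) (hf : IsPosTest f)
    (hg : IsPosTest g) (k j : Fin n) {ε T : ℝ} (hε : 0 < ε) (hεT : ε ≤ T) (m : ℝ) :
    ∫⁻ z in Icc ε T ×ˢ closedBall (0 : Eu n) m,
      ‖heatConv (heatKD k) f z.1 z.2‖ₑ * ‖heatConv (heatKD j) g z.1 z.2‖ₑ ≤
      ENNReal.ofReal ((bellmanK q + 1) * ((∫ x, f x ^ p) + ∫ x, g x ^ q)) := by
  set M := (bellmanK q + 1) * ((∫ x, f x ^ p) + ∫ x, g x ^ q) with hM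
  obtain ⟨φ, hφ, hφs, hφ0, hφ1, hφm, hφδ⟩ :=
    exists_cutoff n m (1 / (T - ε + 1)) (by have : 0 ≤ T - ε := sub_nonneg.2 hεT; positivity)
  have hpos : ∀ {t}, t ∈ Icc ε T → 0 < t := fun ht => hε.trans_le ht.1
  set H : ℝ → Eu n → ℝ := fun t x => ∑ i, bellmanFlowHess p q f g i t x with hH
  have hHc : ContinuousOn (Function.uncurry H) (Ioi 0 ×ˢ univ) := by
    refine (continuousOn_finsetSum Finset.univ fun i _ =>
      continuousOn_bellmanFlowHess (p := p) (q := q) hf hg i).congr fun r _ => ?_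
    simp [hH, Function.uncurry]
  have hHge := fun t (ht : 0 < t) x =>
    two_mul_abs_mul_abs_le_sum_bellmanFlowHess hpq hp hf hg k j ht x
  have hH0 : ∀ t > 0, ∀ x, 0 ≤ H t x := fun t ht x => le_trans (by positivity) (hHge t ht x)
  have hM2 : ∫ t in ε..T, ∫ x, H t x * φ x ≤ 2 * M := by
    refine (integral_bellmanFlowHess_le hp hpq.symm.lt hf hg hε hεT hφ hφs hφ0 hφ1 hφδ).trans ?_
    have hT : 0 ≤ T - ε := sub_nonneg.2 hεT
    have h1 : 1 / (T - ε + 1) * (T - ε) ≤ 1 := by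
      rw [one_div, inv_mul_le_iff₀ (by positivity)]; linarith
    have hM0 : 0 ≤ M := by
      have : 0 < bellmanK q := by
        have := hpq.symm.lt
        have : 0 < q - 1 := by linarith
        unfold bellmanK; positivity
      have h1 : 0 ≤ ∫ x, f x ^ p := integral_nonneg fun x => Real.rpow_nonneg (hf.nonneg x) _
      have h2 : 0 ≤ ∫ x, g x ^ q := integral_nonneg fun x => Real.rpow_nonneg (hg.nonneg x) _
      positivity
    nlinarith
  have hms : MeasurableSet (Icc ε T ×ˢ closedBall (0 : Eu n) m) :=
    measurableSet_Icc.prod measurableSet_closedBall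
  calc _ ≤ ∫⁻ z in Icc ε T ×ˢ closedBall (0 : Eu n) m,
        ENNReal.ofReal (H z.1 z.2 * φ z.2 / 2) := by
        refine setLIntegral_mono' hms fun z hz => ?_
        rw [Real.enorm_eq_ofReal_abs, Real.enorm_eq_ofReal_abs,
          ← ENNReal.ofReal_mul (abs_nonneg _), hφm z.2 hz.2]
        refine ENNReal.ofReal_le_ofReal ?_
        have := hHge z.1 (hpos hz.1) z.2
        simp only [hH]
        linarith
    _ ≤ ∫⁻ z in Icc ε T ×ˢ univ, ENNReal.ofReal (H z.1 z.2 * φ z.2 / 2) :=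
        lintegral_mono_set (prod_mono le_rfl (subset_univ _))
    _ = ∫⁻ t in Icc ε T, ∫⁻ x, ENNReal.ofReal (H t x * φ x / 2) := by
        rw [Measure.volume_eq_prod, ← Measure.prod_restrict, Measure.restrict_univ,
          lintegral_prod]
        have : AEMeasurable (fun z : ℝ × Eu n => ENNReal.ofReal (H z.1 z.2 * φ z.2 / 2))
            ((volume.prod volume).restrict (Icc ε T ×ˢ univ)) := by
          refine AEMeasurable.ennreal_ofReal (ContinuousOn.aemeasurable ?_
            (measurableSet_Icc.prod MeasurableSet.univ))
          exact ((hHc.mono (prod_mono (fun t ht => hpos ht) le_rfl)).mul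
            (hφ.continuous.comp continuous_snd).continuousOn).div_const 2
        rwa [← Measure.prod_restrict, Measure.restrict_univ] at this
    _ = ∫⁻ t in Icc ε T, ENNReal.ofReal ((∫ x, H t x * φ x) / 2) := by
        refine setLIntegral_congr_fun measurableSet_Icc fun t ht => ?_
        rw [← integral_div, ofReal_integral_eq_lintegral_ofReal]
        · exact (((continuous_slice hHc (hpos ht)).mul
            hφ.continuous).integrable_of_hasCompactSupport hφs.mul_left).div_const 2
        · exact Filter.Eventually.of_forall fun x =>
            div_nonneg (mul_nonneg (hH0 t (hpos ht) x) (hφ0 x)) zero_le_two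
    _ = ENNReal.ofReal (∫ t in Icc ε T, (∫ x, H t x * φ x) / 2) := by
        rw [ofReal_integral_eq_lintegral_ofReal]
        · refine Integrable.div_const ?_ 2
          exact ContinuousOn.integrableOn_Icc (ContinuousOn.mono
            (continuousOn_integral_mul_of_hasCompactSupport hφ.continuous hφs hHc)
            fun t ht => hpos ht)
        · refine (ae_restrict_iff' measurableSet_Icc).2 (Filter.Eventually.of_forall fun t ht => ?_)
          exact div_nonneg (integral_nonneg fun x => mul_nonneg (hH0 t (hpos ht) x) (hφ0 x))
            zero_le_two
    _ ≤ ENNReal.ofReal M := by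
        refine ENNReal.ofReal_le_ofReal ?_
        rw [integral_div, integral_Icc_eq_integral_Ioc, ← intervalIntegral.integral_of_le hεT]
        linarith

lemma lintegral_mul_le_of_isPosTest (hpq : p.HolderConjugate q) (hp : 2 ≤ p)
    (hf : IsPosTest f) (hg : IsPosTest g) (k j : Fin n) {ε T : ℝ} (hε : 0 < ε) (hεT : ε ≤ T) :
    ∫⁻ z in Icc ε T ×ˢ (univ : Set (Eu n)),
      ‖heatConv (heatKD k) f z.1 z.2‖ₑ * ‖heatConv (heatKD j) g z.1 z.2‖ₑ ≤
      ENNReal.ofReal ((bellmanK q + 1) * ((∫ x, f x ^ p) + ∫ x, g x ^ q)) := by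
  have hU : Icc ε T ×ˢ (univ : Set (Eu n)) = ⋃ m : ℕ, Icc ε T ×ˢ closedBall (0 : Eu n) m := by
    rw [← prod_iUnion, iUnion_closedBall_nat]
  rw [hU, setLIntegral_iUnion_of_directed]
  · exact iSup_le fun m => lintegral_closedBall_mul_le hpq hp hf hg k j hε hεT m
  · refine Monotone.directed_le fun a b hab => prod_mono le_rfl (closedBall_subset_closedBall ?_)
    exact_mod_cast hab

end Embedding

/-- The `L^p` norm of a real function, as a real number. -/
def realLpNorm (p : ℝ) (f : Eu n → ℝ) : ℝ := (∫ x, |f x| ^ p) ^ p⁻¹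

section SignedEmbedding

variable {p q : ℝ} {f g : Eu n → ℝ}

lemma realLpNorm_nonneg (p : ℝ) (f : Eu n → ℝ) : 0 ≤ realLpNorm p f :=
  Real.rpow_nonneg (integral_nonneg fun _ => Real.rpow_nonneg (abs_nonneg _) _) _

lemma continuous_abs_rpow (hp : 0 < p) (hf : Continuous f) : Continuous fun x => |f x| ^ p :=
  hf.abs.rpow_const fun _ => Or.inr hp.le

lemma integrable_abs_rpow (hp : 0 < p) (hf : Continuous f) (hfs : HasCompactSupport f) :
    Integrable fun x => |f x| ^ p :=
  (continuous_abs_rpow hp hf).integrable_of_hasCompactSupport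
    (hfs.comp_left (g := fun s : ℝ => |s| ^ p) (by simp [Real.zero_rpow hp.ne']))

lemma realLpNorm_mono (hp : 0 < p) (hf : Continuous f) (hfs : HasCompactSupport f)
    (hg : Continuous g) (hgs : HasCompactSupport g) (h : ∀ x, |f x| ≤ |g x|) :
    realLpNorm p f ≤ realLpNorm p g := by
  refine Real.rpow_le_rpow (integral_nonneg fun x => Real.rpow_nonneg (abs_nonneg _) _)
    (integral_mono (integrable_abs_rpow hp hf hfs) (integrable_abs_rpow hp hg hgs) fun x => ?_)
    (by positivity)
  exact Real.rpow_le_rpow (abs_nonneg _) (h x) hp.le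

lemma heatConv_const_mul (κ : ℝ → Eu n → ℝ) (c : ℝ) (f : Eu n → ℝ) (t : ℝ) (x : Eu n) :
    heatConv κ (fun y => c * f y) t x = c * heatConv κ f t x := by
  unfold heatConv
  rw [← integral_const_mul]
  congr 1
  ext y
  ring

lemma heatConv_sub {κ : ℝ → Eu n → ℝ} (hκ : ContinuousOn (Function.uncurry κ) (Ioi 0 ×ˢ univ))
    (hf : Continuous f) (hfs : HasCompactSupport f) (hg : Continuous g)
    (hgs : HasCompactSupport g) {t : ℝ} (ht : 0 < t) (x : Eu n) :
    heatConv κ (fun y => f y - g y) t x = heatConv κ f t x - heatConv κ g t x := by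
  unfold heatConv
  have hc : Continuous fun y => κ t (x - y) :=
    (continuous_slice hκ ht).comp (continuous_const.sub continuous_id)
  rw [← integral_sub]
  · congr 1
    ext y
    ring
  · exact (hc.mul hf).integrable_of_hasCompactSupport hfs.mul_left
  · exact (hc.mul hg).integrable_of_hasCompactSupport hgs.mul_left

lemma IsPosTest.realLpNorm_pos (hp : 0 < p) (hf : IsPosTest f) : 0 < realLpNorm p f := by
  obtain ⟨y, hy⟩ := Function.ne_iff.1 hf.ne_zero
  refine Real.rpow_pos_of_pos (Continuous.integral_pos_of_hasCompactSupport_nonneg_nonzero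
    (x := y) (continuous_abs_rpow hp hf.cont)
    (hf.supp.comp_left (g := fun s : ℝ => |s| ^ p) (by simp [Real.zero_rpow hp.ne']))
    (fun x => Real.rpow_nonneg (abs_nonneg _) _) ?_) _
  exact (Real.rpow_pos_of_pos (abs_pos.2 hy) _).ne'

lemma IsPosTest.const_mul (hf : IsPosTest f) {c : ℝ} (hc : 0 < c) :
    IsPosTest fun x => c * f x where
  cont := continuous_const.mul hf.cont
  supp := hf.supp.mul_left
  nonneg x := mul_nonneg hc.le (hf.nonneg x)
  ne_zero := by
    obtain ⟨y, hy⟩ := Function.ne_iff.1 hf.ne_zero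
    exact Function.ne_iff.2 ⟨y, mul_ne_zero hc.ne' hy⟩

lemma IsPosTest.integral_normalize_rpow (hp : 0 < p) (hf : IsPosTest f) :
    ∫ x, ((realLpNorm p f)⁻¹ * f x) ^ p = 1 := by
  have hA := hf.realLpNorm_pos hp
  have h1 : ∀ x, ((realLpNorm p f)⁻¹ * f x) ^ p = ((realLpNorm p f) ^ p)⁻¹ * |f x| ^ p := by
    intro x
    rw [Real.mul_rpow (by positivity) (hf.nonneg x), Real.inv_rpow hA.le,
      abs_of_nonneg (hf.nonneg x)]
  simp_rw [h1]
  rw [integral_const_mul]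
  have h2 : realLpNorm p f ^ p = ∫ x, |f x| ^ p := by
    unfold realLpNorm
    rw [← Real.rpow_mul (integral_nonneg fun x => Real.rpow_nonneg (abs_nonneg _) _),
      inv_mul_cancel₀ hp.ne', Real.rpow_one]
  rw [h2, inv_mul_cancel₀]
  rw [← h2]
  positivity

lemma lintegral_mul_le_of_isPosTest_of_two_le (hpq : p.HolderConjugate q) (hp : 2 ≤ p)
    (hf : IsPosTest f) (hg : IsPosTest g) (k j : Fin n) {ε T : ℝ} (hε : 0 < ε) (hεT : ε ≤ T) :
    ∫⁻ z in Icc ε T ×ˢ (univ : Set (Eu n)),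
      ‖heatConv (heatKD k) f z.1 z.2‖ₑ * ‖heatConv (heatKD j) g z.1 z.2‖ₑ ≤
      ENNReal.ofReal ((bellmanK q + 1) * 2 * (realLpNorm p f * realLpNorm q g)) := by
  have hA := hf.realLpNorm_pos hpq.pos
  have hB := hg.realLpNorm_pos hpq.symm.pos
  set A := realLpNorm p f with hAdef
  set B := realLpNorm q g with hBdef
  have h := lintegral_mul_le_of_isPosTest hpq hp (hf.const_mul (inv_pos.2 hA))
    (hg.const_mul (inv_pos.2 hB)) k j hε hεT
  rw [hf.integral_normalize_rpow hpq.pos, hg.integral_normalize_rpow hpq.symm.pos,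
    one_add_one_eq_two] at h
  have e : ∀ z : ℝ × Eu n,
      ‖heatConv (heatKD k) f z.1 z.2‖ₑ * ‖heatConv (heatKD j) g z.1 z.2‖ₑ =
      ENNReal.ofReal (A * B) * (‖heatConv (heatKD k) (fun x => A⁻¹ * f x) z.1 z.2‖ₑ *
        ‖heatConv (heatKD j) (fun x => B⁻¹ * g x) z.1 z.2‖ₑ) := by
    intro z
    rw [heatConv_const_mul, heatConv_const_mul, ← Real.enorm_of_nonneg (by positivity),
      ← enorm_mul, ← enorm_mul, ← enorm_mul]
    congr 1
    field_simp
  simp_rw [e]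
  rw [lintegral_const_mul' _ _ ENNReal.ofReal_ne_top, mul_comm (_ * 2),
    ENNReal.ofReal_mul (p := A * B) (mul_nonneg hA.le hB.le)]
  exact mul_le_mul' le_rfl h

/-- The bilinear embedding for nonnegative test functions. -/
lemma exists_lintegral_mul_le_of_nonneg (hpq : p.HolderConjugate q) :
    ∃ C : ℝ, 0 ≤ C ∧ ∀ f g : Eu n → ℝ, Continuous f → HasCompactSupport f → (∀ x, 0 ≤ f x) →
      Continuous g → HasCompactSupport g → (∀ x, 0 ≤ g x) → ∀ (k j : Fin n) (ε T : ℝ), 0 < ε →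
      ε ≤ T → ∫⁻ z in Icc ε T ×ˢ (univ : Set (Eu n)),
        ‖heatConv (heatKD k) f z.1 z.2‖ₑ * ‖heatConv (heatKD j) g z.1 z.2‖ₑ ≤
        ENNReal.ofReal (C * (realLpNorm p f * realLpNorm q g)) := by
  have zero : ∀ (k : Fin n) t x, heatConv (heatKD k) (0 : Eu n → ℝ) t x = 0 := by
    simp [heatConv]
  have hK : ∀ {r : ℝ}, 1 < r → 0 < bellmanK r := fun {r} hr => by
    have : 0 < r - 1 := by linarith
    unfold bellmanK; positivity
  have reduce : ∀ C : ℝ, (∀ f g : Eu n → ℝ, IsPosTest f → IsPosTest g →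
      ∀ (k j : Fin n) (ε T : ℝ), 0 < ε →
      ε ≤ T → ∫⁻ z in Icc ε T ×ˢ (univ : Set (Eu n)),
        ‖heatConv (heatKD k) f z.1 z.2‖ₑ * ‖heatConv (heatKD j) g z.1 z.2‖ₑ ≤
        ENNReal.ofReal (C * (realLpNorm p f * realLpNorm q g))) →
      ∀ f g : Eu n → ℝ, Continuous f → HasCompactSupport f → (∀ x, 0 ≤ f x) →
      Continuous g → HasCompactSupport g → (∀ x, 0 ≤ g x) → ∀ (k j : Fin n) (ε T : ℝ), 0 < ε →
      ε ≤ T → ∫⁻ z in Icc ε T ×ˢ (univ : Set (Eu n)),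
        ‖heatConv (heatKD k) f z.1 z.2‖ₑ * ‖heatConv (heatKD j) g z.1 z.2‖ₑ ≤
        ENNReal.ofReal (C * (realLpNorm p f * realLpNorm q g)) := by
    intro C h f g hf hfs hf0 hg hgs hg0 k j ε T hε hεT
    by_cases h1 : f = 0
    · simp [h1, zero]
    by_cases h2 : g = 0
    · simp [h2, zero]
    exact h f g ⟨hf, hfs, hf0, h1⟩ ⟨hg, hgs, hg0, h2⟩ k j ε T hε hεT
  by_cases hp : 2 ≤ p
  · exact ⟨(bellmanK q + 1) * 2, by have := hK hpq.symm.lt; positivity,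
      reduce _ fun f g hf hg k j ε T hε hεT =>
        lintegral_mul_le_of_isPosTest_of_two_le hpq hp hf hg k j hε hεT⟩
  · have hq : 2 ≤ q := by
      have h1 := hpq.inv_add_inv_eq_one
      have hp0 := hpq.pos
      have h2 : 2⁻¹ ≤ p⁻¹ := inv_anti₀ hp0 (le_of_not_ge hp)
      have h3 : q⁻¹ ≤ 2⁻¹ := by norm_num at *; linarith
      exact (inv_le_inv₀ hpq.symm.pos (by norm_num)).1 h3
    refine ⟨(bellmanK p + 1) * 2, by have := hK hpq.lt; positivity,
      reduce _ fun f g hf hg k j ε T hε hεT => ?_⟩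
    have := lintegral_mul_le_of_isPosTest_of_two_le hpq.symm hq hg hf j k hε hεT
    rw [mul_comm (realLpNorm p f)]
    simpa only [mul_comm] using this

/-- The bilinear embedding for gradients of heat extensions. -/
lemma exists_lintegral_mul_le (hpq : p.HolderConjugate q) :
    ∃ C : ℝ, 0 ≤ C ∧ ∀ f g : Eu n → ℝ, Continuous f → HasCompactSupport f →
      Continuous g → HasCompactSupport g → ∀ (k j : Fin n) (ε T : ℝ), 0 < ε →
      ε ≤ T → ∫⁻ z in Icc ε T ×ˢ (univ : Set (Eu n)),
        ‖heatConv (heatKD k) f z.1 z.2‖ₑ * ‖heatConv (heatKD j) g z.1 z.2‖ₑ ≤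
        ENNReal.ofReal (C * (realLpNorm p f * realLpNorm q g)) := by
  obtain ⟨C, hC, h⟩ := exists_lintegral_mul_le_of_nonneg (n := n) hpq
  refine ⟨4 * C, by positivity, fun f g hf hfs hg hgs k j ε T hε hεT => ?_⟩
  have part : ∀ {r : ℝ} {f : Eu n → ℝ}, 0 < r → Continuous f → HasCompactSupport f → ∀ σ : ℝ,
      |σ| = 1 → Continuous (fun x => max (σ * f x) 0) ∧
      HasCompactSupport (fun x => max (σ * f x) 0) ∧
      realLpNorm r (fun x => max (σ * f x) 0) ≤ realLpNorm r f := by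
    intro r f hr hf hfs σ hσ
    have c : Continuous (fun x => max (σ * f x) 0) := (continuous_const.mul hf).max continuous_const
    have s : HasCompactSupport (fun x => max (σ * f x) 0) :=
      hfs.comp_left (g := fun y : ℝ => max (σ * y) 0) (by simp)
    refine ⟨c, s, realLpNorm_mono hr c s hf hfs fun x => ?_⟩
    rw [abs_of_nonneg (le_max_right _ _)]
    refine max_le ((le_abs_self _).trans_eq ?_) (abs_nonneg _)
    rw [abs_mul, hσ, one_mul]
  have split : ∀ {f : Eu n → ℝ}, Continuous f → HasCompactSupport f → ∀ (k : Fin n) {t : ℝ},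
      0 < t → ∀ x, ‖heatConv (heatKD k) f t x‖ₑ ≤
        ‖heatConv (heatKD k) (fun x => max (1 * f x) 0) t x‖ₑ +
        ‖heatConv (heatKD k) (fun x => max (-1 * f x) 0) t x‖ₑ := by
    intro f hf hfs k t ht x
    obtain ⟨c1, s1, -⟩ := part one_pos hf hfs 1 (by simp)
    obtain ⟨c2, s2, -⟩ := part one_pos hf hfs (-1) (by simp)
    have e : f = fun x => max (1 * f x) 0 - max (-1 * f x) 0 := by
      ext x
      rcases le_total 0 (f x) with h | h <;> simp [h]
    conv_lhs => rw [e]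
    rw [heatConv_sub (continuousOn_heatKD k) c1 s1 c2 s2 ht x]
    exact enorm_sub_le
  have meas : ∀ {f : Eu n → ℝ}, Continuous f → HasCompactSupport f → ∀ (k : Fin n),
      AEMeasurable (fun z : ℝ × Eu n => ‖heatConv (heatKD k) f z.1 z.2‖ₑ)
        (volume.restrict (Icc ε T ×ˢ (univ : Set (Eu n)))) := by
    intro f hf hfs k
    refine AEMeasurable.enorm (ContinuousOn.aemeasurable ?_
      (measurableSet_Icc.prod MeasurableSet.univ))
    exact (continuousOn_uncurry_heatConv hf hfs (continuousOn_heatKD k)).mono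
      (prod_mono (fun t ht => hε.trans_le ht.1) le_rfl)
  set F : ℝ → Eu n → ℝ := fun σ x => max (σ * f x) 0 with hF
  set G : ℝ → Eu n → ℝ := fun σ x => max (σ * g x) 0 with hG
  have I : ∀ σ τ : ℝ, |σ| = 1 → |τ| = 1 → ∫⁻ z in Icc ε T ×ˢ (univ : Set (Eu n)),
        ‖heatConv (heatKD k) (F σ) z.1 z.2‖ₑ * ‖heatConv (heatKD j) (G τ) z.1 z.2‖ₑ ≤
        ENNReal.ofReal (C * (realLpNorm p f * realLpNorm q g)) := by
    intro σ τ hσ hτ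
    obtain ⟨c1, s1, b1⟩ := part hpq.pos hf hfs σ hσ
    obtain ⟨c2, s2, b2⟩ := part hpq.symm.pos hg hgs τ hτ
    refine (h _ _ c1 s1 (fun x => le_max_right _ _) c2 s2 (fun x => le_max_right _ _) k j ε T hε
      hεT).trans (ENNReal.ofReal_le_ofReal ?_)
    have := realLpNorm_nonneg q (G τ)
    have := realLpNorm_nonneg p f
    gcongr
  have M : ∀ σ τ : ℝ, |σ| = 1 → |τ| = 1 → AEMeasurable (fun z : ℝ × Eu n =>
        ‖heatConv (heatKD k) (F σ) z.1 z.2‖ₑ * ‖heatConv (heatKD j) (G τ) z.1 z.2‖ₑ)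
        (volume.restrict (Icc ε T ×ˢ (univ : Set (Eu n)))) := by
    intro σ τ hσ hτ
    obtain ⟨c1, s1, -⟩ := part hpq.pos hf hfs σ hσ
    obtain ⟨c2, s2, -⟩ := part hpq.symm.pos hg hgs τ hτ
    exact (meas c1 s1 k).mul (meas c2 s2 j)
  calc _ ≤ ∫⁻ z in Icc ε T ×ˢ (univ : Set (Eu n)),
        ((‖heatConv (heatKD k) (F 1) z.1 z.2‖ₑ * ‖heatConv (heatKD j) (G 1) z.1 z.2‖ₑ +
        ‖heatConv (heatKD k) (F (-1)) z.1 z.2‖ₑ * ‖heatConv (heatKD j) (G 1) z.1 z.2‖ₑ) +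
        (‖heatConv (heatKD k) (F 1) z.1 z.2‖ₑ * ‖heatConv (heatKD j) (G (-1)) z.1 z.2‖ₑ +
        ‖heatConv (heatKD k) (F (-1)) z.1 z.2‖ₑ * ‖heatConv (heatKD j) (G (-1)) z.1 z.2‖ₑ)) := by
        refine setLIntegral_mono' (measurableSet_Icc.prod MeasurableSet.univ) fun z hz => ?_
        have ht : 0 < z.1 := hε.trans_le hz.1.1
        refine (mul_le_mul' (split hf hfs k ht z.2) (split hg hgs j ht z.2)).trans_eq ?_
        rw [mul_add, add_mul, add_mul]
    _ = _ := by
        have M1 := M 1 1 (by simp) (by simp)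
        rw [lintegral_add_left' (M1.fun_add (M (-1) 1 (by simp) (by simp))),
          lintegral_add_left' M1, lintegral_add_left' (M 1 (-1) (by simp) (by simp))]
    _ ≤ _ := add_le_add (add_le_add (I 1 1 (by simp) (by simp)) (I (-1) 1 (by simp) (by simp)))
        (add_le_add (I 1 (-1) (by simp) (by simp)) (I (-1) (-1) (by simp) (by simp)))
    _ = _ := by
        have h0 : 0 ≤ C * (realLpNorm p f * realLpNorm q g) :=
          mul_nonneg hC (mul_nonneg (realLpNorm_nonneg _ _) (realLpNorm_nonneg _ _))
        rw [← ENNReal.ofReal_add h0 h0, ← ENNReal.ofReal_add (by positivity) (by positivity)]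
        congr 1
        ring

end SignedEmbedding

/-! ### Semigroup identities and limits of the heat flow -/

section Semigroup

variable {f g : Eu n → ℝ}

lemma integral_mul_heatConv {b : Eu n → ℝ} {C : ℝ} (hb : Continuous b) (hbC : ∀ x, |b x| ≤ C)
    {κ : ℝ → Eu n → ℝ} {t : ℝ} (hκ : Integrable (κ t)) (hg : Integrable g) :
    ∫ x, b x * heatConv κ g t x = ∫ y, (∫ x, b x * κ t (x - y)) * g y := by
  have hI : Integrable (fun z : Eu n × Eu n => b z.1 * (κ t (z.1 - z.2) * g z.2))
      (volume.prod volume) := by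
    refine Integrable.bdd_mul (c := C) ?_ (hb.comp continuous_fst).aestronglyMeasurable
      (Filter.Eventually.of_forall fun z => hbC z.1)
    refine (hg.convolution_integrand (ContinuousLinearMap.mul ℝ ℝ) hκ).congr
      (Filter.Eventually.of_forall fun z => ?_)
    simp [mul_comm]
  unfold heatConv
  simp_rw [← integral_const_mul, ← integral_mul_const]
  rw [integral_integral_swap hI]
  simp_rw [mul_assoc]

lemma heatConv_partialD (hf : ContDiff ℝ (⊤ : ℕ∞) f) (hfs : HasCompactSupport f) (k : Fin n)
    {t : ℝ} (ht : 0 < t) (x : Eu n) :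
    heatConv heatK (partialD k f) t x = heatConv (heatKD k) f t x := by
  have hs : Continuous fun y : Eu n => x - y := continuous_const.sub continuous_id
  have h := integral_lineDeriv_mul_eq_neg (a := fun y => heatK t (x - y))
    (a' := fun y => -heatKD k t (x - y)) (v := EuclideanSpace.single k 1)
    ((continuous_heatK ht).comp hs) ((continuous_heatKD k ht).comp hs).neg hf.continuous
    (contDiff_partialD hf k).continuous hfs (hasCompactSupport_partialD hfs k) ?_
    (hasLineDerivAt_partialD hf k)
  · unfold heatConv
    simp only [neg_mul, integral_neg] at h
    linarith
  · intro y
    have h0 := hasLineDerivAt_heatK k ht (x - y)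
    unfold HasLineDerivAt at h0 ⊢
    have h1 := HasDerivAt.scomp (h := fun r : ℝ => -r) 0 (by simpa using h0) (hasDerivAt_neg 0)
    simp only [smul_eq_mul, neg_one_mul] at h1
    refine h1.congr_of_eventuallyEq (Filter.Eventually.of_forall fun r => ?_)
    simp only [Function.comp]
    congr 1
    module

lemma abs_heatK_le {t : ℝ} (ht : 0 < t) (z : Eu n) :
    |heatK t z| ≤ (4 * Real.pi * t) ^ (-(n / 2 : ℝ)) := by
  rw [abs_of_pos (heatK_pos ht z)]
  exact heatK_le ht z

lemma heatConv_heatKD_two_mul (hg : Integrable g) (j : Fin n) {t : ℝ} (ht : 0 < t) (x : Eu n) :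
    heatConv (heatKD j) g (2 * t) x = heatConv heatK (heatConv (heatKD j) g t) t x := by
  have h := integral_mul_heatConv (b := fun z => heatK t (x - z))
    ((continuous_heatK ht).comp (continuous_const.sub continuous_id))
    (fun z => abs_heatK_le ht _) (integrable_heatKD j ht) hg
  simp_rw [integral_heatK_mul_heatKD j ht] at h
  exact h.symm

lemma integral_mul_heatConv_heatKD_two_mul (hf : Continuous f) (hfs : HasCompactSupport f)
    (hg : Integrable g) (j : Fin n) {t : ℝ} (ht : 0 < t) :
    ∫ x, f x * heatConv (heatKD j) g (2 * t) x =
      ∫ z, heatConv heatK f t z * heatConv (heatKD j) g t z := by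
  obtain ⟨C, hC⟩ := hf.bounded_above_of_compact_support hfs
  simp_rw [heatConv_heatKD_two_mul hg j ht]
  rw [integral_mul_heatConv hf hC (integrable_heatK ht)
    (integrable_heatConv (integrable_heatKD j ht) hg)]
  congr 1
  ext z
  congr 1
  unfold heatConv
  congr 1
  ext x
  rw [heatK_sub_comm, mul_comm]

lemma abs_heatConv_heatK_le {C : ℝ} (hC : ∀ x, |g x| ≤ C) {t : ℝ} (ht : 0 < t) (x : Eu n) :
    |heatConv heatK g t x| ≤ C := by
  have hki : Integrable fun y => heatK t (x - y) := (integrable_heatK ht).comp_sub_left x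
  have hk1 : ∫ y, heatK t (x - y) = 1 := by
    rw [integral_sub_left_eq_self (heatK t) volume x, integral_heatK ht]
  rw [← Real.norm_eq_abs, heatConv]
  refine (norm_integral_le_of_norm_le (g := fun y => heatK t (x - y) * C) (hki.mul_const C)
    (Filter.Eventually.of_forall fun y => ?_)).trans_eq ?_
  · rw [norm_mul, Real.norm_of_nonneg (heatK_pos ht _).le]
    exact mul_le_mul_of_nonneg_left (hC y) (heatK_pos ht _).le
  · rw [integral_mul_const, hk1, one_mul]

lemma tendsto_heatConv_heatK (hg : Continuous g) (hgs : HasCompactSupport g) (x : Eu n) :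
    Filter.Tendsto (fun c : ℝ => heatConv heatK g (1 / (4 * Real.pi ^ 2 * c)) x) Filter.atTop
      (nhds (g x)) := by
  have hgc : Integrable (fun y => (g y : ℂ)) :=
    (hg.integrable_of_hasCompactSupport hgs).ofReal
  have h := Real.tendsto_integral_gaussian_smul' hgc (v := x)
    (Complex.continuous_ofReal.comp hg).continuousAt
  have h2 := (Complex.continuous_re.tendsto _).comp h
  rw [Complex.ofReal_re] at h2
  refine h2.congr' ?_
  filter_upwards [Filter.Ioi_mem_atTop 0] with c hc
  have hc0 : (0 : ℝ) < c := hc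
  have hpi := Real.pi_pos
  simp only [Function.comp]
  have e : ∀ w, (((Real.pi : ℂ) * c) ^ (Module.finrank ℝ (Eu n) / 2 : ℂ) *
      Complex.exp (-(Real.pi : ℂ) ^ 2 * c * (‖x - w‖ : ℂ) ^ 2)) • (g w : ℂ) =
      ((heatK (1 / (4 * Real.pi ^ 2 * c)) (x - w) * g w : ℝ) : ℂ) := by
    intro w
    unfold heatK
    have e1 : 4 * Real.pi * (1 / (4 * Real.pi ^ 2 * c)) = (Real.pi * c)⁻¹ := by
      field_simp
    have e2 : -‖x - w‖ ^ 2 / (4 * (1 / (4 * Real.pi ^ 2 * c))) =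
        -Real.pi ^ 2 * c * ‖x - w‖ ^ 2 := by
      field_simp
    rw [e1, e2, Real.rpow_neg (by positivity), Real.inv_rpow (by positivity), inv_inv]
    push_cast
    rw [Complex.ofReal_cpow (by positivity)]
    simp
  simp_rw [e]
  rw [integral_complex_ofReal, Complex.ofReal_re]
  rfl

lemma tendsto_integral_heatConv_mul (hf : Continuous f) (hfs : HasCompactSupport f)
    (hg : Continuous g) (hgs : HasCompactSupport g) :
    Filter.Tendsto (fun c : ℝ => ∫ x, heatConv heatK g (1 / (4 * Real.pi ^ 2 * c)) x * f x)
      Filter.atTop (nhds (∫ x, g x * f x)) := by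
  obtain ⟨C, hC⟩ := hg.bounded_above_of_compact_support hgs
  have hpi := Real.pi_pos
  refine tendsto_integral_filter_of_dominated_convergence (fun x => C * |f x|) ?_ ?_
    ((hf.integrable_of_hasCompactSupport hfs).abs.const_mul C)
    (Filter.Eventually.of_forall fun x => (tendsto_heatConv_heatK hg hgs x).mul_const _)
  · filter_upwards [Filter.Ioi_mem_atTop 0] with c hc
    have hc0 : (0 : ℝ) < c := hc
    exact ((continuous_heatConv hg hgs continuousOn_heatK (by positivity)).mul
      hf).aestronglyMeasurable
  · filter_upwards [Filter.Ioi_mem_atTop 0] with c hc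
    have hc0 : (0 : ℝ) < c := hc
    refine Filter.Eventually.of_forall fun x => ?_
    rw [norm_mul]
    exact mul_le_mul_of_nonneg_right (abs_heatConv_heatK_le hC (by positivity) x) (abs_nonneg _)

lemma abs_integral_heatConv_mul_le (hf : Continuous f) (hfs : HasCompactSupport f)
    (hg : Continuous g) (hgs : HasCompactSupport g) {t : ℝ} (ht : 0 < t) :
    |∫ x, heatConv heatK g t x * f x| ≤
      (4 * Real.pi * t) ^ (-(n / 2 : ℝ)) * (∫ x, |g x|) * ∫ x, |f x| := by
  have hgi := hg.integrable_of_hasCompactSupport (μ := volume) hgs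
  have hfi := hf.integrable_of_hasCompactSupport (μ := volume) hfs
  rw [← integral_const_mul, ← Real.norm_eq_abs]
  refine norm_integral_le_of_norm_le (hfi.abs.const_mul _) (Filter.Eventually.of_forall fun x => ?_)
  rw [norm_mul]
  refine mul_le_mul_of_nonneg_right ?_ (abs_nonneg _)
  rw [← integral_const_mul, heatConv]
  refine norm_integral_le_of_norm_le (hgi.abs.const_mul _) (Filter.Eventually.of_forall fun y => ?_)
  rw [norm_mul]
  exact mul_le_mul_of_nonneg_right (abs_heatK_le ht _) (abs_nonneg _)

lemma tendsto_integral_heatConv_mul_atTop (hn : 0 < n) (hf : Continuous f)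
    (hfs : HasCompactSupport f) (hg : Continuous g) (hgs : HasCompactSupport g) :
    Filter.Tendsto (fun t : ℝ => ∫ x, heatConv heatK g t x * f x) Filter.atTop (nhds 0) := by
  have hn' : (0 : ℝ) < n / 2 := by positivity
  have h1 : Filter.Tendsto (fun t : ℝ => (4 * Real.pi * t) ^ (-(n / 2 : ℝ)) * (∫ x, |g x|) *
      ∫ x, |f x|) Filter.atTop (nhds 0) := by
    have := ((tendsto_rpow_neg_atTop hn').comp (Filter.tendsto_id.const_mul_atTop
      (show 0 < 4 * Real.pi by positivity))).mul_const (∫ x, |g x|) |>.mul_const (∫ x, |f x|)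
    simpa using this
  refine squeeze_zero_norm' ?_ h1
  filter_upwards [Filter.Ioi_mem_atTop 0] with t ht
  exact abs_integral_heatConv_mul_le hf hfs hg hgs ht

end Semigroup

/-! ### Dual estimate for solutions of a second order equation -/

section Pairing

variable {p q : ℝ} {a g : Eu n → ℝ}

lemma continuousOn_integral_heatConv_heatKD_mul (hg : Continuous g) (hgs : HasCompactSupport g)
    (j : Fin n) {h : Eu n → ℝ} (hh : Continuous h) (hhs : HasCompactSupport h) :
    ContinuousOn (fun s => ∫ x, heatConv (heatKD j) g s x * h x) (Ioi 0) :=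
  continuousOn_integral_mul_of_hasCompactSupport hh hhs
    (continuousOn_uncurry_heatConv hg hgs (continuousOn_heatKD j))

lemma abs_integral_integral_heatConv_le {D ε T : ℝ} (hD : 0 ≤ D) (hε : 0 < ε) (hεT : ε ≤ T)
    (ha : ContDiff ℝ (⊤ : ℕ∞) a) (has : HasCompactSupport a) (hg : Continuous g)
    (hgs : HasCompactSupport g) (k j : Fin n)
    (hemb : ∫⁻ z in Icc ε T ×ˢ (univ : Set (Eu n)),
        ‖heatConv (heatKD k) a z.1 z.2‖ₑ * ‖heatConv (heatKD j) g z.1 z.2‖ₑ ≤ ENNReal.ofReal D) :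
    |∫ t in ε..T, ∫ x, heatConv (heatKD j) g (2 * t) x * partialD k a x| ≤ D := by
  have hgi := hg.integrable_of_hasCompactSupport (μ := volume) hgs
  have e : ∀ t > 0, ∫ x, heatConv (heatKD j) g (2 * t) x * partialD k a x =
      ∫ z, heatConv (heatKD k) a t z * heatConv (heatKD j) g t z := by
    intro t ht
    simp_rw [mul_comm (heatConv (heatKD j) g (2 * t) _)]
    rw [integral_mul_heatConv_heatKD_two_mul (contDiff_partialD ha k).continuous
      (hasCompactSupport_partialD has k) hgi j ht]
    simp_rw [heatConv_partialD ha has k ht]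
  rw [← ENNReal.ofReal_le_ofReal_iff hD, ← Real.enorm_eq_ofReal_abs,
    intervalIntegral.integral_of_le hεT, ← integral_Icc_eq_integral_Ioc]
  refine (enorm_integral_le_lintegral_enorm _).trans (le_trans ?_ hemb)
  have hm : AEMeasurable (fun z : ℝ × Eu n =>
      ‖heatConv (heatKD k) a z.1 z.2‖ₑ * ‖heatConv (heatKD j) g z.1 z.2‖ₑ)
      ((volume.restrict (Icc ε T)).prod volume) := by
    have : AEMeasurable (fun z : ℝ × Eu n =>
        ‖heatConv (heatKD k) a z.1 z.2‖ₑ * ‖heatConv (heatKD j) g z.1 z.2‖ₑ)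
        ((volume.prod volume).restrict (Icc ε T ×ˢ univ)) := by
      have hms : MeasurableSet (Icc ε T ×ˢ (univ : Set (Eu n))) :=
        measurableSet_Icc.prod MeasurableSet.univ
      have hsub : Icc ε T ×ˢ (univ : Set (Eu n)) ⊆ Ioi 0 ×ˢ univ :=
        prod_mono (fun t ht => hε.trans_le ht.1) le_rfl
      exact (ContinuousOn.aemeasurable ((continuousOn_uncurry_heatConv ha.continuous has
        (continuousOn_heatKD k)).mono hsub) hms).enorm.mul
        (ContinuousOn.aemeasurable ((continuousOn_uncurry_heatConv hg hgs
        (continuousOn_heatKD j)).mono hsub) hms).enorm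
    rwa [← Measure.prod_restrict, Measure.restrict_univ] at this
  rw [Measure.volume_eq_prod, ← Measure.prod_restrict, Measure.restrict_univ, lintegral_prod _ hm]
  refine setLIntegral_mono' measurableSet_Icc fun t ht => ?_
  rw [e t (hε.trans_le ht.1)]
  refine (enorm_integral_le_lintegral_enorm _).trans_eq ?_
  simp_rw [enorm_mul]

lemma hasDerivAt_integral_heatConv_mul {w : Eu n → ℝ} (hw : ContDiff ℝ (⊤ : ℕ∞) w)
    (hws : HasCompactSupport w) {h : Fin n → Eu n → ℝ} (hh : ∀ j, ContDiff ℝ (⊤ : ℕ∞) (h j))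
    (hhs : ∀ j, HasCompactSupport (h j))
    (hΔ : ∀ x, ∑ j, partialD j (partialD j w) x = ∑ j, partialD j (h j) x)
    (hg : Continuous g) (hgs : HasCompactSupport g) {s : ℝ} (hs : 0 < s) :
    HasDerivAt (fun s => ∫ x, heatConv heatK g s x * w x)
      (-∑ j, ∫ x, heatConv (heatKD j) g s x * h j x) s := by
  have c0 := continuous_heatConv hg hgs continuousOn_heatK hs
  have c1 := fun j => continuous_heatConv hg hgs (continuousOn_heatKD j) hs
  have c2 := fun j => continuous_heatConv hg hgs (continuousOn_heatKDD j) hs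
  have d0 := fun j x => hasLineDerivAt_heatConv hg hgs continuousOn_heatK (continuousOn_heatKD j)
      (fun t ht z => hasLineDerivAt_heatK j ht z) hs x
  have d1 := fun j x => hasLineDerivAt_heatConv hg hgs (continuousOn_heatKD j)
    (continuousOn_heatKDD j) (fun t ht z => hasLineDerivAt_heatKD j ht z) hs x
  have ibp : ∀ {φ : Eu n → ℝ}, ContDiff ℝ (⊤ : ℕ∞) φ → HasCompactSupport φ → ∀ j,
      ∫ x, heatConv (heatKD j) g s x * φ x = -∫ x, heatConv heatK g s x * partialD j φ x :=
    fun hφ hφs j => integral_lineDeriv_mul_eq_neg c0 (c1 j) hφ.continuous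
      (contDiff_partialD hφ j).continuous hφs (hasCompactSupport_partialD hφs j) (d0 j)
      (hasLineDerivAt_partialD hφ j)
  have ibp1 : ∀ j, ∫ x, heatConv (heatKDD j) g s x * w x =
      ∫ x, heatConv heatK g s x * partialD j (partialD j w) x := by
    intro j
    rw [integral_lineDeriv_mul_eq_neg (c1 j) (c2 j) hw.continuous
      (contDiff_partialD hw j).continuous hws (hasCompactSupport_partialD hws j) (d1 j)
      (hasLineDerivAt_partialD hw j), ibp (contDiff_partialD hw j)
      (hasCompactSupport_partialD hws j), neg_neg]
  have int0 : ∀ {φ : Eu n → ℝ}, ContDiff ℝ (⊤ : ℕ∞) φ → HasCompactSupport φ → ∀ j,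
      Integrable fun x => heatConv heatK g s x * partialD j φ x := fun hφ hφs j =>
    (c0.mul (contDiff_partialD hφ j).continuous).integrable_of_hasCompactSupport
      (hasCompactSupport_partialD hφs j).mul_left
  refine (hasDerivAt_integral_mul_of_hasCompactSupport hw.continuous hws isOpen_Ioi
    (continuousOn_uncurry_heatConv hg hgs continuousOn_heatK)
    (b' := fun s x => ∑ j, heatConv (heatKDD j) g s x) ?_
    (fun s hs y => hasDerivAt_heatConv_heatK hg hgs hs y) hs).congr_deriv ?_
  · refine (continuousOn_finsetSum Finset.univ fun j _ =>
      continuousOn_uncurry_heatConv hg hgs (continuousOn_heatKDD j)).congr fun r _ => ?_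
    simp [Function.uncurry]
  · simp_rw [Finset.sum_mul]
    rw [integral_finsetSum]
    · simp_rw [ibp1, ibp (hh _) (hhs _)]
      rw [Finset.sum_neg_distrib, neg_neg, ← integral_finsetSum, ← integral_finsetSum]
      · simp_rw [← Finset.mul_sum, hΔ]
      · exact fun j _ => int0 (hh j) (hhs j) j
      · exact fun j _ => int0 (contDiff_partialD hw j) (hasCompactSupport_partialD hws j) j
    · exact fun j _ => ((c2 j).mul hw.continuous).integrable_of_hasCompactSupport hws.mul_left

lemma partialD_sub {f h : Eu n → ℝ} (hf : ContDiff ℝ (⊤ : ℕ∞) f) (hh : ContDiff ℝ (⊤ : ℕ∞) h)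
    (i : Fin n) (x : Eu n) :
    partialD i (fun y => f y - h y) x = partialD i f x - partialD i h x := by
  unfold partialD
  rw [fderiv_fun_sub (hf.differentiable (by simp) x) (hh.differentiable (by simp) x)]
  rfl

/-- If `Δ w = ∑ j, ∂ⱼ (∂ₖ aⱼ - ∂ᵢ bⱼ)`, then `w` is controlled in `L^p`, by duality, by
the functions `aⱼ` and `bⱼ`. -/
lemma exists_abs_integral_mul_le (hn : 0 < n) (hpq : p.HolderConjugate q) :
    ∃ C : ℝ, 0 ≤ C ∧ ∀ (w : Eu n → ℝ) (a b : Fin n → Eu n → ℝ) (i k : Fin n) (g : Eu n → ℝ),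
      ContDiff ℝ (⊤ : ℕ∞) w → HasCompactSupport w → (∀ j, ContDiff ℝ (⊤ : ℕ∞) (a j)) →
      (∀ j, HasCompactSupport (a j)) → (∀ j, ContDiff ℝ (⊤ : ℕ∞) (b j)) →
      (∀ j, HasCompactSupport (b j)) →
      (∀ x, ∑ j, partialD j (partialD j w) x =
        ∑ j, partialD j (fun y => partialD k (a j) y - partialD i (b j) y) x) →
      Continuous g → HasCompactSupport g →
      |∫ x, g x * w x| ≤
        C * ((∑ j, (realLpNorm p (a j) + realLpNorm p (b j))) * realLpNorm q g) := by
  obtain ⟨C, hC, hemb⟩ := exists_lintegral_mul_le (n := n) hpq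
  refine ⟨2 * C, by positivity, ?_⟩
  intro w a b i k g hw hws ha has hb hbs hΔ hg hgs
  set h : Fin n → Eu n → ℝ := fun j y => partialD k (a j) y - partialD i (b j) y with hhdef
  have hh : ∀ j, ContDiff ℝ (⊤ : ℕ∞) (h j) := fun j =>
    (contDiff_partialD (ha j) k).sub (contDiff_partialD (hb j) i)
  have hhs : ∀ j, HasCompactSupport (h j) := fun j =>
    (hasCompactSupport_partialD (has j) k).sub (hasCompactSupport_partialD (hbs j) i)
  set D : ℝ := 2 * C * ((∑ j, (realLpNorm p (a j) + realLpNorm p (b j))) * realLpNorm q g) with hD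
  set B : ℝ → ℝ := fun s => ∫ x, heatConv heatK g s x * w x with hB
  have hBd : ∀ t > 0, HasDerivAt (fun t => B (2 * t))
      (∑ j, -2 * ∫ x, heatConv (heatKD j) g (2 * t) x * h j x) t := by
    intro t ht
    have h1 := (hasDerivAt_integral_heatConv_mul hw hws hh hhs hΔ hg hgs
      (show 0 < 2 * t by positivity)).scomp t ((hasDerivAt_id t).const_mul 2)
    refine HasDerivAt.congr_deriv h1 ?_
    rw [← Finset.mul_sum, smul_eq_mul]
    ring
  have hcont : ∀ {φ : Eu n → ℝ}, Continuous φ → HasCompactSupport φ → ∀ j {ε T : ℝ}, 0 < ε →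
      ε ≤ T → IntervalIntegrable (fun t => ∫ x, heatConv (heatKD j) g (2 * t) x * φ x) volume
        ε T := by
    intro φ hφ hφs j ε T hε hεT
    refine ContinuousOn.intervalIntegrable ?_
    rw [uIcc_of_le hεT]
    refine (continuousOn_integral_heatConv_heatKD_mul hg hgs j hφ hφs).comp
      (f := fun t : ℝ => 2 * t) (by fun_prop) fun t ht => ?_
    have : 0 < t := hε.trans_le ht.1
    simpa using this
  have hbound : ∀ ε T : ℝ, 0 < ε → ε ≤ T → |B (2 * T) - B (2 * ε)| ≤ D := by
    intro ε T hε hεT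
    rw [← intervalIntegral.integral_eq_sub_of_hasDerivAt (f := fun t => B (2 * t))
      (fun t ht => hBd t (by rw [uIcc_of_le hεT] at ht; exact hε.trans_le ht.1))
      (by
        simpa only [Finset.sum_fn] using IntervalIntegrable.sum Finset.univ fun j _ =>
          (hcont (hh j).continuous (hhs j) j hε hεT).const_mul (-2)),
      intervalIntegral.integral_finsetSum fun j _ =>
        (hcont (hh j).continuous (hhs j) j hε hεT).const_mul (-2)]
    refine (Finset.abs_sum_le_sum_abs _ _).trans ?_
    rw [hD, Finset.sum_mul, Finset.mul_sum]
    refine Finset.sum_le_sum fun j _ => ?_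
    have cA := (contDiff_partialD (ha j) k).continuous
    have sA := hasCompactSupport_partialD (has j) k
    have cB := (contDiff_partialD (hb j) i).continuous
    have sB := hasCompactSupport_partialD (hbs j) i
    have hsplit : ∫ t in ε..T, ∫ x, heatConv (heatKD j) g (2 * t) x * h j x =
        (∫ t in ε..T, ∫ x, heatConv (heatKD j) g (2 * t) x * partialD k (a j) x) -
        ∫ t in ε..T, ∫ x, heatConv (heatKD j) g (2 * t) x * partialD i (b j) x := by
      rw [← intervalIntegral.integral_sub (hcont cA sA j hε hεT) (hcont cB sB j hε hεT)]
      refine intervalIntegral.integral_congr fun t ht => ?_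
      rw [uIcc_of_le hεT] at ht
      have ht0 : 0 < 2 * t := by have : 0 < t := hε.trans_le ht.1; positivity
      have cG := continuous_heatConv hg hgs (continuousOn_heatKD j) ht0
      simp only [hhdef, mul_sub]
      exact integral_sub ((cG.mul cA).integrable_of_hasCompactSupport sA.mul_left)
        ((cG.mul cB).integrable_of_hasCompactSupport sB.mul_left)
    have nn : ∀ f : Eu n → ℝ, 0 ≤ C * (realLpNorm p f * realLpNorm q g) := fun f =>
      mul_nonneg hC (mul_nonneg (realLpNorm_nonneg _ _) (realLpNorm_nonneg _ _))
    have b1 := abs_integral_integral_heatConv_le (nn (a j)) hε hεT (ha j) (has j) hg hgs k j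
      (hemb _ _ (ha j).continuous (has j) hg hgs k j ε T hε hεT)
    have b2 := abs_integral_integral_heatConv_le (nn (b j)) hε hεT (hb j) (hbs j) hg hgs i j
      (hemb _ _ (hb j).continuous (hbs j) hg hgs i j ε T hε hεT)
    rw [intervalIntegral.integral_const_mul, hsplit, abs_mul]
    norm_num
    have := abs_sub (∫ t in ε..T, ∫ x, heatConv (heatKD j) g (2 * t) x * partialD k (a j) x)
      (∫ t in ε..T, ∫ x, heatConv (heatKD j) g (2 * t) x * partialD i (b j) x)
    linarith
  have hzero : ∀ ε > 0, |B (2 * ε)| ≤ D := by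
    intro ε hε
    have h1 := (((tendsto_integral_heatConv_mul_atTop hn hw.continuous hws hg hgs).comp
      (Filter.tendsto_id.const_mul_atTop (zero_lt_two' ℝ))).sub_const (B (2 * ε))).abs
    rw [zero_sub, abs_neg] at h1
    refine le_of_tendsto h1 ?_
    filter_upwards [Filter.Ici_mem_atTop ε] with T hT
    exact hbound ε T hε hT
  refine le_of_tendsto (tendsto_integral_heatConv_mul hw.continuous hws hg hgs).abs ?_
  filter_upwards [Filter.Ioi_mem_atTop 0] with c hc
  have hc0 : (0 : ℝ) < c := hc
  have hpi := Real.pi_pos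
  have := hzero (1 / (4 * Real.pi ^ 2 * c) / 2) (by positivity)
  rwa [mul_div_cancel₀ _ two_ne_zero] at this

end Pairing

/-! ### Korn's inequality for the entries of the Jacobian -/

section Korn

variable {p q : ℝ}

/-- The duality map `s ↦ |s| ^ (p - 2) s`. -/
def dualityMap (p s : ℝ) : ℝ := max s 0 ^ (p - 1) - max (-s) 0 ^ (p - 1)

lemma continuous_dualityMap (hp : 1 < p) : Continuous (dualityMap p) := by
  unfold dualityMap
  exact ((continuous_id.max continuous_const).rpow_const fun _ => Or.inr (by linarith)).sub
    ((continuous_id.neg.max continuous_const).rpow_const fun _ => Or.inr (by linarith))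

lemma dualityMap_zero (p : ℝ) : dualityMap p 0 = 0 := by simp [dualityMap]

lemma dualityMap_of_nonneg (hp : 1 < p) {s : ℝ} (hs : 0 ≤ s) : dualityMap p s = s ^ (p - 1) := by
  rw [dualityMap, max_eq_left hs, max_eq_right (by linarith), Real.zero_rpow (by linarith), sub_zero]

lemma dualityMap_neg (p s : ℝ) : dualityMap p (-s) = -dualityMap p s := by
  simp [dualityMap]

lemma dualityMap_mul_self (hp : 1 < p) (s : ℝ) : dualityMap p s * s = |s| ^ p := by
  have h : ∀ r : ℝ, 0 ≤ r → dualityMap p r * r = |r| ^ p := fun r hr => by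
    rw [dualityMap_of_nonneg hp hr, abs_of_nonneg hr, ← Real.rpow_add_one' hr (by linarith),
      sub_add_cancel]
  rcases le_total 0 s with hs | hs
  · exact h s hs
  · simpa [dualityMap_neg] using h (-s) (by linarith)

lemma abs_dualityMap_rpow (hpq : p.HolderConjugate q) (s : ℝ) :
    |dualityMap p s| ^ q = |s| ^ p := by
  have h : ∀ r : ℝ, 0 ≤ r → |dualityMap p r| ^ q = |r| ^ p := fun r hr => by
    rw [dualityMap_of_nonneg hpq.lt hr, abs_of_nonneg hr, abs_of_nonneg (Real.rpow_nonneg hr _),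
      ← Real.rpow_mul hr, hpq.sub_one_mul_conj]
  rcases le_total 0 s with hs | hs
  · exact h s hs
  · simpa [dualityMap_neg] using h (-s) (by linarith)

lemma realLpNorm_le_of_forall_abs_integral_mul_le (hpq : p.HolderConjugate q) {A : ℝ} (hA : 0 ≤ A)
    {w : Eu n → ℝ} (hw : Continuous w) (hws : HasCompactSupport w)
    (h : ∀ g : Eu n → ℝ, Continuous g → HasCompactSupport g →
      |∫ x, g x * w x| ≤ A * realLpNorm q g) :
    realLpNorm p w ≤ A := by
  have h1 := h (fun x => dualityMap p (w x)) ((continuous_dualityMap hpq.lt).comp hw)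
    (hws.comp_left (dualityMap_zero p))
  simp only [dualityMap_mul_self hpq.lt, realLpNorm, abs_dualityMap_rpow hpq] at h1
  unfold realLpNorm
  have hI : 0 ≤ ∫ x, |w x| ^ p := integral_nonneg fun x => Real.rpow_nonneg (abs_nonneg _) _
  rw [abs_of_nonneg hI] at h1
  rcases hI.eq_or_lt with h0 | h0
  · rw [← h0, Real.zero_rpow (inv_ne_zero hpq.ne_zero)]
    exact hA
  · have hq : 0 < (∫ x, |w x| ^ p) ^ q⁻¹ := Real.rpow_pos_of_pos h0 _
    refine le_of_mul_le_mul_right ?_ hq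
    rwa [← Real.rpow_add h0, hpq.inv_add_inv_eq_one, Real.rpow_one]

lemma partialD_add {f h : Eu n → ℝ} (hf : ContDiff ℝ (⊤ : ℕ∞) f) (hh : ContDiff ℝ (⊤ : ℕ∞) h)
    (i : Fin n) (x : Eu n) :
    partialD i (fun y => f y + h y) x = partialD i f x + partialD i h x := by
  unfold partialD
  rw [fderiv_fun_add (hf.differentiable (by simp) x) (hh.differentiable (by simp) x)]
  rfl

/-- The entries of the symmetric gradient of `v`. -/
def strain (v : Fin n → Eu n → ℝ) (i j : Fin n) (x : Eu n) : ℝ :=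
  1 / 2 * (partialD j (v i) x + partialD i (v j) x)

/-- The entries of the skew-symmetric gradient of `v`. -/
def vorticity (v : Fin n → Eu n → ℝ) (i k : Fin n) (x : Eu n) : ℝ :=
  1 / 2 * (partialD k (v i) x - partialD i (v k) x)

variable {v : Fin n → Eu n → ℝ}

lemma contDiff_strain (hv : ∀ i, ContDiff ℝ (⊤ : ℕ∞) (v i)) (i j : Fin n) :
    ContDiff ℝ (⊤ : ℕ∞) (strain v i j) :=
  contDiff_const.mul ((contDiff_partialD (hv i) j).add (contDiff_partialD (hv j) i))

lemma hasCompactSupport_strain (hvs : ∀ i, HasCompactSupport (v i)) (i j : Fin n) :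
    HasCompactSupport (strain v i j) :=
  ((hasCompactSupport_partialD (hvs i) j).add (hasCompactSupport_partialD (hvs j) i)).mul_left

lemma contDiff_vorticity (hv : ∀ i, ContDiff ℝ (⊤ : ℕ∞) (v i)) (i j : Fin n) :
    ContDiff ℝ (⊤ : ℕ∞) (vorticity v i j) :=
  contDiff_const.mul ((contDiff_partialD (hv i) j).sub (contDiff_partialD (hv j) i))

lemma hasCompactSupport_vorticity (hvs : ∀ i, HasCompactSupport (v i)) (i j : Fin n) :
    HasCompactSupport (vorticity v i j) :=
  ((hasCompactSupport_partialD (hvs i) j).sub (hasCompactSupport_partialD (hvs j) i)).mul_left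

lemma partialD_vorticity (hv : ∀ i, ContDiff ℝ (⊤ : ℕ∞) (v i)) (i j k : Fin n) :
    partialD j (vorticity v i k) =
      fun x => partialD k (strain v i j) x - partialD i (strain v j k) x := by
  have d := fun i j => contDiff_partialD (hv i) j
  funext x
  unfold vorticity strain
  rw [partialD_const_mul ((d i k).sub (d k i)), partialD_const_mul ((d i j).add (d j i)),
    partialD_const_mul ((d j k).add (d k j))]
  simp only [partialD_sub (d i k) (d k i), partialD_add (d i j) (d j i),
    partialD_add (d j k) (d k j)]
  rw [partialD_comm (hv i) j k, partialD_comm (hv k) j i, partialD_comm (hv j) k i]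
  ring

/-- The entries of the skew-symmetric gradient are controlled in `L^p` by the symmetric
gradient. -/
lemma exists_realLpNorm_vorticity_le (hn : 0 < n) (hpq : p.HolderConjugate q) :
    ∃ C : ℝ, 0 ≤ C ∧ ∀ v : Fin n → Eu n → ℝ, (∀ i, ContDiff ℝ (⊤ : ℕ∞) (v i)) →
      (∀ i, HasCompactSupport (v i)) → ∀ i k, realLpNorm p (vorticity v i k) ≤
        C * ∑ j, (realLpNorm p (strain v i j) + realLpNorm p (strain v j k)) := by
  obtain ⟨C, hC, hle⟩ := exists_abs_integral_mul_le (n := n) hn hpq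
  refine ⟨C, hC, fun v hv hvs i k => ?_⟩
  refine realLpNorm_le_of_forall_abs_integral_mul_le hpq (mul_nonneg hC (Finset.sum_nonneg
    fun j _ => add_nonneg (realLpNorm_nonneg _ _) (realLpNorm_nonneg _ _)))
    (contDiff_vorticity hv i k).continuous (hasCompactSupport_vorticity hvs i k)
    fun g hg hgs => ?_
  rw [mul_assoc]
  exact hle (vorticity v i k) (strain v i) (fun j => strain v j k) i k g
    (contDiff_vorticity hv i k) (hasCompactSupport_vorticity hvs i k)
    (contDiff_strain hv i) (hasCompactSupport_strain hvs i)
    (fun j => contDiff_strain hv j k) (fun j => hasCompactSupport_strain hvs j k)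
    (fun x => Finset.sum_congr rfl fun j _ => by rw [partialD_vorticity hv i j k]) hg hgs

lemma eLpNorm_eq_ofReal_realLpNorm (hp : 0 < p) {f : Eu n → ℝ} (hf : Continuous f)
    (hfs : HasCompactSupport f) :
    eLpNorm f (ENNReal.ofReal p) volume = ENNReal.ofReal (realLpNorm p f) := by
  rw [(hf.memLp_of_hasCompactSupport hfs).eLpNorm_eq_integral_rpow_norm
    (by simpa using hp) ENNReal.ofReal_ne_top, ENNReal.toReal_ofReal hp.le]
  rfl

end Korn

attribute [local instance] Matrix.frobeniusNormedAddCommGroup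

variable (n)

section Frobenius

variable {n}

lemma frobenius_norm_sq (A : Matrix (Fin n) (Fin n) ℝ) :
    ‖A‖ ^ 2 = ∑ s : Fin n × Fin n, |A s.1 s.2| ^ 2 := by
  have h : 0 ≤ ∑ i, ∑ j, |A i j| ^ 2 :=
    Finset.sum_nonneg fun i _ => Finset.sum_nonneg fun j _ => sq_nonneg _
  rw [Matrix.frobenius_norm_def, Fintype.sum_prod_type]
  simp_rw [Real.norm_eq_abs, Real.rpow_two]
  rw [← Real.sqrt_eq_rpow, Real.sq_sqrt h]

lemma frobenius_norm_le_sum_abs (A : Matrix (Fin n) (Fin n) ℝ) :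
    ‖A‖ ≤ ∑ s : Fin n × Fin n, |A s.1 s.2| := by
  refine le_of_sq_le_sq ?_ (Finset.sum_nonneg fun s _ => abs_nonneg _)
  rw [frobenius_norm_sq]
  exact Finset.sum_sq_le_sq_sum_of_nonneg fun s _ => abs_nonneg _

lemma abs_apply_le_frobenius_norm (A : Matrix (Fin n) (Fin n) ℝ) (i j : Fin n) :
    |A i j| ≤ ‖A‖ := by
  refine le_of_sq_le_sq ?_ (norm_nonneg A)
  rw [frobenius_norm_sq]
  exact Finset.single_le_sum (f := fun s : Fin n × Fin n => |A s.1 s.2| ^ 2)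
    (fun s _ => sq_nonneg _) (Finset.mem_univ (i, j))

end Frobenius

/-- classical Korn inequality on the whole space in L^p. -/
theorem stmt5 (hn : 0 < n) (p : ℝ) (hp : 1 < p) :
    ∃ c > (0 : ℝ), ∀ u : Eu n → Eu n, ContDiff ℝ (⊤ : ℕ∞) u → HasCompactSupport u →
      ENNReal.ofReal c * eLpNorm (fun x => jacobianM u x) (ENNReal.ofReal p) volume ≤
        eLpNorm (fun x => symPart (jacobianM u x)) (ENNReal.ofReal p) volume := by
  have hp0 : 0 < p := by linarith
  have hp1 : 1 ≤ ENNReal.ofReal p := by simpa using hp.le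
  obtain ⟨C, hC, hle⟩ := exists_realLpNorm_vorticity_le hn (Real.HolderConjugate.conjExponent hp)
  set K : ℝ := (n * n : ℝ) * (1 + C * (n * 2)) with hK
  have hn' : (0 : ℝ) < n := by exact_mod_cast hn
  have hKpos : 0 < K := by positivity
  refine ⟨K⁻¹, inv_pos.2 hKpos, fun u hu hus => ?_⟩
  set v : Fin n → Eu n → ℝ := fun i z => u z i with hv
  have hvc : ∀ i, ContDiff ℝ (⊤ : ℕ∞) (v i) := fun i => (contDiff_euclidean.1 hu) i
  have hvs : ∀ i, HasCompactSupport (v i) := fun i =>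
    hus.comp_left (g := fun y : Eu n => y i) rfl
  have cE := fun i k => (contDiff_strain hvc i k).continuous
  have sE := fun i k => hasCompactSupport_strain hvs i k
  have cW := fun i k => (contDiff_vorticity hvc i k).continuous
  have sW := fun i k => hasCompactSupport_vorticity hvs i k
  set S := eLpNorm (fun x => symPart (jacobianM u x)) (ENNReal.ofReal p) volume with hS
  have hEn : ∀ i k, eLpNorm (strain v i k) (ENNReal.ofReal p) volume ≤ S := fun i k =>
    eLpNorm_mono fun x => abs_apply_le_frobenius_norm (symPart (jacobianM u x)) i k
  have hWn : ∀ i k, eLpNorm (vorticity v i k) (ENNReal.ofReal p) volume ≤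
      ENNReal.ofReal (C * (n * 2)) * S := by
    intro i k
    rw [eLpNorm_eq_ofReal_realLpNorm hp0 (cW i k) (sW i k)]
    refine (ENNReal.ofReal_le_ofReal (hle v hvc hvs i k)).trans ?_
    rw [ENNReal.ofReal_mul hC, ENNReal.ofReal_mul hC, mul_assoc]
    gcongr
    rw [ENNReal.ofReal_sum_of_nonneg fun j _ =>
      add_nonneg (realLpNorm_nonneg _ _) (realLpNorm_nonneg _ _)]
    calc _ ≤ ∑ _j : Fin n, 2 * S := by
          refine Finset.sum_le_sum fun j _ => ?_
          rw [ENNReal.ofReal_add (realLpNorm_nonneg _ _) (realLpNorm_nonneg _ _),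
            ← eLpNorm_eq_ofReal_realLpNorm hp0 (cE i j) (sE i j),
            ← eLpNorm_eq_ofReal_realLpNorm hp0 (cE j k) (sE j k), two_mul]
          exact add_le_add (hEn i j) (hEn j k)
      _ = ENNReal.ofReal (n * 2) * S := by
          rw [ENNReal.ofReal_mul hn'.le]
          simp [mul_assoc]
  have hJ : ∀ i k, (fun x => jacobianM u x i k) = strain v i k + vorticity v i k := by
    intro i k
    funext x
    simp only [Pi.add_apply, strain, vorticity, partialD, jacobianM, Matrix.of_apply, hv]
    ring
  have hJc : ∀ i k, Continuous fun x => jacobianM u x i k := fun i k => by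
    rw [hJ]
    exact (cE i k).add (cW i k)
  have hJn : ∀ i k, eLpNorm (fun x => jacobianM u x i k) (ENNReal.ofReal p) volume ≤
      ENNReal.ofReal (1 + C * (n * 2)) * S := by
    intro i k
    rw [hJ, ENNReal.ofReal_add zero_le_one (by positivity), add_mul, ENNReal.ofReal_one, one_mul]
    exact (eLpNorm_add_le (cE i k).aestronglyMeasurable (cW i k).aestronglyMeasurable hp1).trans
      (add_le_add (hEn i k) (hWn i k))
  have hmain : eLpNorm (fun x => jacobianM u x) (ENNReal.ofReal p) volume ≤
      ENNReal.ofReal K * S := by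
    calc _ ≤ eLpNorm (∑ s : Fin n × Fin n, fun x => ‖jacobianM u x s.1 s.2‖)
            (ENNReal.ofReal p) volume :=
          eLpNorm_mono_real fun x => by
            simpa using frobenius_norm_le_sum_abs (jacobianM u x)
      _ ≤ ∑ s : Fin n × Fin n, eLpNorm (fun x => ‖jacobianM u x s.1 s.2‖)
            (ENNReal.ofReal p) volume :=
          eLpNorm_sum_le (fun s _ => (hJc s.1 s.2).norm.aestronglyMeasurable) hp1
      _ ≤ ∑ _s : Fin n × Fin n, ENNReal.ofReal (1 + C * (n * 2)) * S :=
          Finset.sum_le_sum fun s _ => by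
            rw [eLpNorm_norm]
            exact hJn s.1 s.2
      _ = ENNReal.ofReal K * S := by
          rw [hK, ENNReal.ofReal_mul (by positivity), ENNReal.ofReal_mul hn'.le]
          simp [mul_assoc]
  calc _ ≤ ENNReal.ofReal K⁻¹ * (ENNReal.ofReal K * S) := by gcongr
    _ = S := by
      rw [← mul_assoc, ← ENNReal.ofReal_mul (inv_nonneg.2 hKpos.le), inv_mul_cancel₀ hKpos.ne',
        ENNReal.ofReal_one, one_mul]
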